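/- arXiv:2203.11457 — 14 statements merged into one kernel-verified Lean document; each statement's English description precedes it below -/
import Mathlib

section
/- Let a_1, a_2, a_3 be positive integers with gcd(a_1, a_2, a_3) = 1, and let d = gcd(a_1, a_2). Then G(a_1, a_2, a_3) = d · G(a_1/d, a_2/d, a_3). -/
/-- If `c` is coprime to `d`, every residue class modulo `d` is cleared by a multiple of `c`
with multiplier less than `d`. -/
theorem exists_lt_dvd_add_mul {c d : ℕ} (hd : 0 < d) (h : c.Coprime d) (N : ℕ) :
    ∃ z < d, d ∣ N + c * z := by
  have : NeZero d := ⟨hd.ne'⟩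
  refine ⟨(-(N : ZMod d) * (c : ZMod d)⁻¹).val, ZMod.val_lt _, ?_⟩
  rw [← ZMod.natCast_eq_zero_iff]
  push_cast
  rw [ZMod.natCast_zmod_val]
  linear_combination (-(N : ZMod d)) * ZMod.coe_mul_inv_eq_one c h

/-- Johnson's reduction: if `gcd(a1,a2,a3) = 1` and `d = gcd(a1,a2)`, then
`G(a1,a2,a3) = d * G(a1/d, a2/d, a3)`, where `G` denotes the greatest positive integer
not representable as a positive integer combination. -/
theorem stmt_3 (a1 a2 a3 : ℕ) (h1 : 0 < a1) (h2 : 0 < a2) (h3 : 0 < a3)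
    (hgcd : Nat.gcd (Nat.gcd a1 a2) a3 = 1) (d : ℕ) (hd : d = Nat.gcd a1 a2) :
    ∀ g : ℕ,
      IsGreatest {N : ℕ | 0 < N ∧ ¬ ∃ x1 x2 x3 : ℕ, 0 < x1 ∧ 0 < x2 ∧ 0 < x3 ∧
        N = a1 / d * x1 + a2 / d * x2 + a3 * x3} g →
      IsGreatest {N : ℕ | 0 < N ∧ ¬ ∃ x1 x2 x3 : ℕ, 0 < x1 ∧ 0 < x2 ∧ 0 < x3 ∧
        N = a1 * x1 + a2 * x2 + a3 * x3} (d * g) := by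
  have hd0 : 0 < d := hd ▸ Nat.gcd_pos_of_pos_left _ h1
  have hcop : Nat.Coprime d a3 := by rw [hd]; exact hgcd
  obtain ⟨b1, rfl⟩ : d ∣ a1 := hd ▸ Nat.gcd_dvd_left _ _
  obtain ⟨b2, rfl⟩ : d ∣ a2 := hd ▸ Nat.gcd_dvd_right _ _
  rw [Nat.mul_div_cancel_left _ hd0, Nat.mul_div_cancel_left _ hd0]
  rintro g ⟨⟨hg0, hg⟩, hmax⟩
  refine ⟨⟨Nat.mul_pos hd0 hg0, ?_⟩, ?_⟩
  · rintro ⟨x1, x2, x3, hx1, hx2, hx3, h⟩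
    have hdvd : d ∣ a3 * x3 := by
      rw [← Nat.dvd_add_right (Dvd.intro (b1 * x1 + b2 * x2) rfl)]
      exact ⟨g, by rw [h]; ring⟩
    obtain ⟨y, rfl⟩ := hcop.dvd_of_dvd_mul_left hdvd
    refine hg ⟨x1, x2, y, hx1, hx2, Nat.pos_of_mul_pos_left hx3, ?_⟩
    apply Nat.eq_of_mul_eq_mul_left hd0
    rw [h]
    ring
  · rintro N ⟨hN0, hN⟩
    by_contra! hlt
    obtain ⟨z, hz, K, hK⟩ := exists_lt_dvd_add_mul hd0 hcop.symm N
    have hgK : g < K := Nat.lt_of_mul_lt_mul_left (a := d) (by omega)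
    have hrep : ∃ x1 x2 x3 : ℕ, 0 < x1 ∧ 0 < x2 ∧ 0 < x3 ∧
        K = b1 * x1 + b2 * x2 + a3 * x3 := by
      by_contra hn
      exact absurd (hmax ⟨by omega, hn⟩) (by omega)
    obtain ⟨x1, x2, y, hx1, hx2, hy, rfl⟩ := hrep
    have hzy : z < d * y := hz.trans_le (Nat.le_mul_of_pos_right d hy)
    obtain ⟨w, hw⟩ := Nat.exists_eq_add_of_lt hzy
    refine hN ⟨x1, x2, w + 1, hx1, hx2, w.succ_pos, ?_⟩
    zify at hK hw ⊢
    linear_combination hK + a3 * hw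
end

section
/- Let a_1, a_2, a_3 be positive integers with gcd(a_1, a_2) = 1, and suppose a_3 = a_1·u + a_2·v for some non-negative integers u, v (i.e., a_3 is a non-negative integer combination of a_1 and a_2). Then G(a_1, a_2, a_3) = a_1·a_2 + a_3. -/
/-- The product of two coprime positive integers is not a combination of them with positive
coefficients. -/
theorem Nat.Coprime.mul_ne_mul_add_mul_of_pos {a b x y : ℕ} (hab : Nat.Coprime a b)
    (ha : 0 < a) (hx : 0 < x) (hy : 0 < y) : a * b ≠ a * x + b * y := by
  intro h
  have hdvd : a ∣ b * y :=
    (Nat.dvd_add_right (Nat.dvd_mul_right a x)).1 (h ▸ Nat.dvd_mul_right a b)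
  have hle : a ≤ y := Nat.le_of_dvd hy (hab.dvd_of_dvd_mul_left hdvd)
  nlinarith [Nat.mul_le_mul_left b hle, Nat.mul_pos ha hx]

/-- Every integer exceeding the product of two coprime positive integers is a combination of
them with positive coefficients. -/
theorem Nat.Coprime.exists_pos_mul_add_mul_eq {a b n : ℕ} (hab : Nat.Coprime a b)
    (ha : 0 < a) (hb : 0 < b) (hn : a * b < n) :
    ∃ x y : ℕ, 0 < x ∧ 0 < y ∧ n = a * x + b * y := by
  obtain ⟨a, rfl⟩ := Nat.exists_eq_add_of_lt ha
  obtain ⟨b, rfl⟩ := Nat.exists_eq_add_of_lt hb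
  simp only [Nat.zero_add] at *
  obtain ⟨m, rfl⟩ : ∃ m, n = m + (a + 1) + (b + 1) := by
    have : a + b + 2 ≤ n := by nlinarith
    exact ⟨n - (a + 1) - (b + 1), by omega⟩
  obtain ⟨x, y, hxy⟩ := Nat.exists_add_mul_eq_of_gcd_dvd_of_mul_pred_le (a + 1) (b + 1) m
    (by simp [hab.gcd_eq_one]) (by simp only [Nat.pred_succ]; nlinarith)
  exact ⟨x + 1, y + 1, by omega, by omega, by rw [← hxy]; ring⟩

/-- If `gcd(a1,a2) = 1` and `a3` is a non-negative combination of `a1, a2`,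
then `G(a1,a2,a3) = a1*a2 + a3`. -/
theorem stmt_4 (a1 a2 a3 : ℕ) (h1 : 0 < a1) (h2 : 0 < a2) (h3 : 0 < a3)
    (hcop : Nat.gcd a1 a2 = 1) (u v : ℕ) (h3rep : a3 = a1 * u + a2 * v) :
    IsGreatest {N : ℕ | 0 < N ∧ ¬ ∃ x1 x2 x3 : ℕ, 0 < x1 ∧ 0 < x2 ∧ 0 < x3 ∧
      N = a1 * x1 + a2 * x2 + a3 * x3} (a1 * a2 + a3) := by
  have hab : Nat.Coprime a1 a2 := hcop
  refine ⟨⟨by positivity, ?_⟩, ?_⟩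
  · rintro ⟨x1, x2, x3, hx1, hx2, hx3, h⟩
    obtain ⟨k, rfl⟩ := Nat.exists_eq_add_of_lt hx3
    refine hab.mul_ne_mul_add_mul_of_pos h1 (x := x1 + u * k) (y := x2 + v * k)
      (by omega) (by omega) ?_
    subst h3rep
    linarith
  · rintro N ⟨-, hN⟩
    by_contra! hlt
    obtain ⟨x, y, hx, hy, h⟩ := hab.exists_pos_mul_add_mul_eq h1 h2 (n := N - a3) (by omega)
    exact hN ⟨x, y, 1, hx, hy, one_pos, by omega⟩
end

section
/- In the sequence setup described in the context, there exist integers p_{-1}, p_0, ..., p_k with p_{-1} = 0, p_0 = 1, and p_j > 0 for all 0 ≤ j ≤ k, such that b'_j · a_2 = b_j · a_1 + (−1)^j · p_j · a_3 holds for all −1 ≤ j ≤ k. -/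
/-- The sequence with `p 0 = 0`, `p 1 = 1` and `p (n + 2) = p n + m n * p (n + 1)`. -/
def continuantSeq (m : ℕ → ℤ) : ℕ → ℤ
  | 0 => 0
  | 1 => 1
  | n + 2 => continuantSeq m n + m n * continuantSeq m (n + 1)

theorem continuantSeq_nonneg_and_pos {m : ℕ → ℤ} {k : ℕ} (hm : ∀ i < k, 0 < m i) :
    ∀ n ≤ k, 0 ≤ continuantSeq m n ∧ 0 < continuantSeq m (n + 1) := by
  intro n
  induction n with
  | zero => simp [continuantSeq]
  | succ n ih =>
    intro hn
    obtain ⟨h0, h1⟩ := ih (by lia)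
    refine ⟨h1.le, ?_⟩
    rw [continuantSeq]
    exact add_pos_of_nonneg_of_pos h0 (mul_pos (hm n hn) h1)

/-- In the algorithm's sequence setup (here `b i`, `b' i` denote the paper's
`b_{i-1}`, `b'_{i-1}`, so `b 0 = a2`, `b' 0 = a1` and `b 1, b' 1` are the paper's
`b_0, b'_0`), there exist integers `p n` (representing the paper's `p_{n-1}`) with
`p 0 = 0`, `p 1 = 1`, `p n > 0` for `1 ≤ n ≤ k+1`, such that
`b'_j * a2 = b_j * a1 + (-1)^j * p_j * a3` for all `-1 ≤ j ≤ k`, i.e. in shifted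
indices `b' n * a2 = b n * a1 + (-1)^(n+1) * p n * a3` for all `0 ≤ n ≤ k+1`. -/
theorem stmt_5 (a1 a2 a3 : ℤ) (ha1 : 0 < a1) (ha2 : 0 < a2) (ha3 : 0 < a3)
    (hcop : Int.gcd a1 a2 = 1)
    (k : ℕ) (b b' : ℕ → ℤ) (m : ℕ → ℤ)
    (hb0 : b 0 = a2) (hb'0 : b' 0 = a1)
    (hb'1pos : 0 < b' 1) (hb'1le : b' 1 ≤ a1)
    (ha3eq : a3 = a2 * b' 1 - a1 * b 1)
    (hm : ∀ i : ℕ, i < k → 0 < m i)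
    (hrec : ∀ i : ℕ, i < k → b (i + 2) = b i - m i * b (i + 1))
    (hrec' : ∀ i : ℕ, i < k → b' (i + 2) = b' i - m i * b' (i + 1)) :
    ∃ p : ℕ → ℤ, p 0 = 0 ∧ p 1 = 1 ∧ (∀ n : ℕ, 1 ≤ n → n ≤ k + 1 → 0 < p n) ∧
      ∀ n : ℕ, n ≤ k + 1 → b' n * a2 = b n * a1 + (-1 : ℤ) ^ (n + 1) * p n * a3 := by
  refine ⟨continuantSeq m, rfl, rfl, ?_, ?_⟩
  · rintro (_ | n) h1 hn
    · lia
    · exact (continuantSeq_nonneg_and_pos hm n (by lia)).2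
  · intro n
    induction n using Nat.twoStepInduction with
    | zero =>
      intro _
      simp only [continuantSeq, hb0, hb'0]
      ring
    | one =>
      intro _
      simp only [continuantSeq, ha3eq]
      ring
    | more n ih₀ ih₁ =>
      intro hn
      rw [hrec n (by lia), hrec' n (by lia), continuantSeq]
      linear_combination ih₀ (by lia) - m n * ih₁ (by lia)
end

section
/- Let a_1, a_2, a_3 be positive integers with gcd(a_1, a_2) = 1. Suppose integers b, b', p, c, c', p' satisfy the two relations b·a_1 − b'·a_2 + ε·p·a_3 = 0 and c·a_1 − c'·a_2 − ε·p'·a_3 = 0 (where ε = ±1), together with the determinant condition c·b' − b·c' = −ε·a_3. Then these two relation vectors generate all integer relations among a_1, a_2, a_3: every integer solution (x_1, x_2, x_3) of x_1·a_1 + x_2·a_2 + x_3·a_3 = 0 is an integer linear combination of (b, −b', ε·p) and (c, −c', −ε·p'). -/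
/-- Two consecutive relations produced by the algorithm generate all integer
relations among `a1, a2, a3`: given `b*a1 - b'*a2 + ε*p*a3 = 0`,
`c*a1 - c'*a2 - ε*p'*a3 = 0` and `c*b' - b*c' = -ε*a3` with `ε = ±1`, every integer
solution of `x1*a1 + x2*a2 + x3*a3 = 0` is an integer combination of `(b, -b', ε*p)`
and `(c, -c', -ε*p')`. -/
theorem stmt_9 (a1 a2 a3 : ℤ) (ha1 : 0 < a1) (ha2 : 0 < a2) (ha3 : 0 < a3)
    (hcop : Int.gcd a1 a2 = 1) (ε : ℤ) (hε : ε = 1 ∨ ε = -1)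
    (b b' p c c' p' : ℤ)
    (h1 : b * a1 - b' * a2 + ε * p * a3 = 0)
    (h2 : c * a1 - c' * a2 - ε * p' * a3 = 0)
    (hdet : c * b' - b * c' = -ε * a3) :
    ∀ x1 x2 x3 : ℤ, x1 * a1 + x2 * a2 + x3 * a3 = 0 →
      ∃ α β : ℤ, x1 = α * b + β * c ∧ x2 = α * (-b') + β * (-c') ∧
        x3 = α * (ε * p) + β * (-(ε * p')) := by
  have hsq : ε * ε = 1 := by rcases hε with rfl | rfl <;> norm_num
  have k1 : ε * (b' * p' + p * c') + ε * a1 = 0 := by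
    refine (mul_eq_zero.mp ?_).resolve_right ha3.ne'
    linear_combination c' * h1 - b' * h2 + a1 * hdet
  have k2 : ε * (p * c + b * p') + ε * a2 = 0 := by
    refine (mul_eq_zero.mp ?_).resolve_right ha3.ne'
    linear_combination c * h1 - b * h2 + a2 * hdet
  have k3 : c * b' - b * c' + ε * a3 = 0 := by linear_combination hdet
  obtain ⟨s, t, hs⟩ : ∃ s t : ℤ, s * a1 + t * a2 = 1 :=
    Int.isCoprime_iff_gcd_eq_one.mpr hcop
  intro x1 x2 x3 hx
  refine ⟨-ε * (x1 * (ε * p' * t) - x2 * (ε * p' * s) + x3 * (c * t + c' * s)),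
    -ε * (x1 * (ε * p * t) - x2 * (ε * p * s) - x3 * (b * t + b' * s)), ?_, ?_, ?_⟩
  · linear_combination ε * (x1 * (s * k1 + t * k2) - s * (x1 * k1 + x2 * k2 + x3 * k3))
      + ε * ε * s * hx - ε * ε * x1 * hs - x1 * hsq
  · linear_combination ε * (x2 * (s * k1 + t * k2) - t * (x1 * k1 + x2 * k2 + x3 * k3))
      + ε * ε * t * hx - ε * ε * x2 * hs - x2 * hsq
  · linear_combination ε * (x3 * (s * k1 + t * k2)) - ε * ε * x3 * hs - x3 * hsq
end

section
/- Let a_1, a_2, a_3 be positive integers with gcd(a_1, a_2) = 1. Suppose b, c, c', p, p' are positive integers and b' is a non-negative integer such that: b·a_1 = b'·a_2 + p·a_3; c'·a_2 = c·a_1 + p'·a_3; c·b' − b·c' = −a_3; and either b' = 0, or both b > c and b' < c'. Then b = L(a_1 | a_2, a_3) and c' = L(a_2 | a_1, a_3). -/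
/-- If `(b, b')` and `(c, c')` lie in the lattice `{(m, x) : a3 ∣ m * a1 - x * a2}` and their
determinant is `a3`, they generate it when `a1` and `a2` are coprime. -/
theorem exists_lattice_coords {a1 a2 a3 b b' c c' p p' m x y : ℤ} (h3 : a3 ≠ 0)
    (hcop : IsCoprime a1 a2)
    (e1 : b * a1 = b' * a2 + p * a3) (e2 : c' * a2 = c * a1 + p' * a3)
    (hdet : c * b' - b * c' = -a3) (h : m * a1 = a2 * x + a3 * y) :
    ∃ s t : ℤ, m = s * b + t * c ∧ x = s * b' + t * c' ∧ y = s * p - t * p' := by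
  obtain ⟨u, v, huv⟩ := hcop
  obtain ⟨s, hs⟩ : ∃ s, m * c' - x * c = a3 * s :=
    ⟨u * (c' * y + x * p') + v * (c * y + m * p'), by
      linear_combination (-(m * c' - x * c)) * huv + (u * c' + v * c) * h
        + (u * x + v * m) * e2⟩
  obtain ⟨t, ht⟩ : ∃ t, b * x - m * b' = a3 * t :=
    ⟨u * (x * p - b' * y) + v * (m * p - b * y), by
      linear_combination (-(b * x - m * b')) * huv - (u * b' + v * b) * h
        + (u * x + v * m) * e1⟩
  have hm : m = s * b + t * c := mul_left_cancel₀ h3 (by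
    linear_combination b * hs + c * ht + m * hdet)
  have hx : x = s * b' + t * c' := mul_left_cancel₀ h3 (by
    linear_combination b' * hs + c' * ht + x * hdet)
  refine ⟨s, t, hm, hx, mul_left_cancel₀ h3 ?_⟩
  linear_combination -h + a1 * hm - a2 * hx + s * e1 - t * e2


/-- (Paper's Lemma 7, odd round.) With `gcd(a1,a2) = 1`, relations
`b*a1 = b'*a2 + p*a3`, `c'*a2 = c*a1 + p'*a3`, determinant `c*b' - b*c' = -a3`, and
either `b' = 0` or (`b > c` and `b' < c'`), the numbers `b` and `c'` are respectively
`L(a1 | a2, a3)` and `L(a2 | a1, a3)`, the least positive multipliers making a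
non-negative combination of the other two numbers. -/
theorem stmt_10 (a1 a2 a3 : ℕ) (h1 : 0 < a1) (h2 : 0 < a2) (h3 : 0 < a3)
    (hcop : Nat.gcd a1 a2 = 1)
    (b b' c c' p p' : ℕ) (hb : 0 < b) (hc : 0 < c) (hc' : 0 < c')
    (hp : 0 < p) (hp' : 0 < p')
    (e1 : b * a1 = b' * a2 + p * a3)
    (e2 : c' * a2 = c * a1 + p' * a3)
    (hdet : (c : ℤ) * b' - b * c' = -(a3 : ℤ))
    (hcase : b' = 0 ∨ (c < b ∧ b' < c')) :
    IsLeast {m : ℕ | 0 < m ∧ ∃ x y : ℕ, m * a1 = a2 * x + a3 * y} b ∧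
    IsLeast {m : ℕ | 0 < m ∧ ∃ x y : ℕ, m * a2 = a1 * x + a3 * y} c' := by
  have h3' : (a3 : ℤ) ≠ 0 := by exact_mod_cast h3.ne'
  have hcop' : IsCoprime (a1 : ℤ) a2 := Nat.isCoprime_iff_coprime.2 hcop
  have e1' : (b : ℤ) * a1 = b' * a2 + p * a3 := by exact_mod_cast e1
  have e2' : (c' : ℤ) * a2 = c * a1 + p' * a3 := by exact_mod_cast e2
  have hcase' : (b' : ℤ) = 0 ∨ ((c : ℤ) < b ∧ (b' : ℤ) < c') := by exact_mod_cast hcase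
  refine ⟨⟨⟨hb, b', p, by linarith⟩, ?_⟩, ⟨⟨hc', c, p', by linarith⟩, ?_⟩⟩
  · rintro m ⟨hm, x, y, h⟩
    have h' : (m : ℤ) * a1 = a2 * x + a3 * y := by exact_mod_cast h
    obtain ⟨s, t, rm, rx, ry⟩ := exists_lattice_coords h3' hcop' e1' e2' hdet h'
    clear h h' e1 e2 e1' e2' hdet hcop hcop' hcase h3'
    have hx : (0 : ℤ) ≤ x := x.cast_nonneg
    have hy : (0 : ℤ) ≤ y := y.cast_nonneg
    zify at *
    have hs : 0 < s := by
      by_contra! hs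
      rcases le_or_gt t 0 with ht | ht
      · linarith [mul_nonneg (neg_nonneg.2 hs) hb.le, mul_nonneg (neg_nonneg.2 ht) hc.le]
      · linarith [mul_nonneg (neg_nonneg.2 hs) hp.le, mul_pos ht hp']
    by_contra! hlt
    have ht : t < 0 := by
      by_contra! ht
      linarith [mul_nonneg (sub_nonneg.2 (Int.add_one_le_of_lt hs)) hb.le, mul_nonneg ht hc.le]
    rcases hcase' with h0 | ⟨hcb, hbc⟩
    · rw [h0] at rx
      linarith [mul_neg_of_neg_of_pos ht hc']
    · have hst : -t < s := by
        by_contra! hst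
        linarith [mul_pos hs (sub_pos.2 hbc), mul_nonneg (sub_nonneg.2 hst) hc'.le]
      linarith [mul_nonneg (Int.sub_nonneg_of_le hs) (sub_nonneg.2 hcb.le),
        mul_nonneg (Int.sub_nonneg_of_le hst) hc.le]
  · rintro m ⟨hm, x, y, h⟩
    have h' : (x : ℤ) * a1 = a2 * m + a3 * (-y) := by
      have : (m : ℤ) * a2 = a1 * x + a3 * y := by exact_mod_cast h
      linarith
    obtain ⟨s, t, rx, rm, ry⟩ := exists_lattice_coords h3' hcop' e1' e2' hdet h'
    clear h h' e1 e2 e1' e2' hdet hcop hcop' hcase h3'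
    have hx : (0 : ℤ) ≤ x := x.cast_nonneg
    have hy : (0 : ℤ) ≤ y := y.cast_nonneg
    have hb' : (0 : ℤ) ≤ b' := b'.cast_nonneg
    zify at *
    have ht : 0 < t := by
      by_contra! ht
      rcases le_or_gt s 0 with hs | hs
      · linarith [mul_nonneg (neg_nonneg.2 hs) hb', mul_nonneg (neg_nonneg.2 ht) hc'.le]
      · linarith [mul_pos hs hp, mul_nonneg (neg_nonneg.2 ht) hp'.le]
    by_contra! hlt
    have htc : 0 ≤ (t - 1) * c' := mul_nonneg (Int.sub_nonneg_of_le ht) hc'.le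
    have hs : s < 0 := by
      by_contra! hs
      linarith [mul_nonneg hs hb']
    rcases hcase' with h0 | ⟨hcb, hbc⟩
    · rw [h0] at rm
      linarith
    · have hst : -s < t := by
        by_contra! hst
        linarith [mul_pos ht (sub_pos.2 hcb), mul_nonneg (sub_nonneg.2 hst) hb.le]
      linarith [mul_nonneg (Int.sub_nonneg_of_le ht) (sub_nonneg.2 hbc.le),
        mul_nonneg (Int.sub_nonneg_of_le hst) hb']
end

section
/- Let a_1, a_2, a_3 be positive integers with gcd(a_1, a_2) = 1. Suppose b, b', c, c', p, p' are positive integers such that: b·a_1 = b'·a_2 + p·a_3; c'·a_2 = c·a_1 + p'·a_3; c·b' − b·c' = −a_3; b > c; and b' < c'. Then the coefficient of a_3 in these representations is maximal: for all non-negative integers x, y with b·a_1 = x·a_2 + y·a_3 one has y ≤ p, and for all non-negative integers x, y with c'·a_2 = x·a_1 + y·a_3 one has y ≤ p'. -/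
/-- Two solutions of `u * a ≡ v * d` modulo `m`, with `a` and `d` coprime, have a determinant
divisible by `m`. -/
theorem dvd_det_of_dvd_sub {a d m u v u' v' : ℤ} (had : IsCoprime a d)
    (h : m ∣ u * a - v * d) (h' : m ∣ u' * a - v' * d) : m ∣ u * v' - v * u' := by
  obtain ⟨r, q, hrq⟩ := had
  obtain ⟨k, hk⟩ := h
  obtain ⟨l, hl⟩ := h'
  exact ⟨r * (v' * k - v * l) + q * (u' * k - u * l), by
    linear_combination (-(u * v' - v * u')) * hrq + (r * v' + q * u') * hk
      - (r * v + q * u) * hl⟩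

/-- Two vectors of the lattice `u * a = v * d + w * m`, with `a` and `d` coprime, whose first two
coordinates have determinant `m`, generate the lattice. -/
theorem exists_eq_combination_of_det_eq {a d m b b' p c c' q u v w : ℤ} (had : IsCoprime a d)
    (hm : m ≠ 0) (h₁ : b * a = b' * d + p * m) (h₂ : c * a = c' * d + q * m)
    (hdet : b * c' - b' * c = m) (h : u * a = v * d + w * m) :
    ∃ s t : ℤ, u = s * b + t * c ∧ v = s * b' + t * c' ∧ w = s * p + t * q := by
  have d₁ : m ∣ b * a - b' * d := ⟨p, by linear_combination h₁⟩
  have d₂ : m ∣ c * a - c' * d := ⟨q, by linear_combination h₂⟩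
  have d₃ : m ∣ u * a - v * d := ⟨w, by linear_combination h⟩
  obtain ⟨s, hs⟩ := dvd_det_of_dvd_sub had d₃ d₂
  obtain ⟨t, ht⟩ := dvd_det_of_dvd_sub had d₁ d₃
  have hu : u = s * b + t * c := mul_left_cancel₀ hm (by
    linear_combination b * hs + c * ht - u * hdet)
  have hv : v = s * b' + t * c' := mul_left_cancel₀ hm (by
    linear_combination b' * hs + c' * ht - v * hdet)
  refine ⟨s, t, hu, hv, mul_left_cancel₀ hm ?_⟩
  linear_combination -h + s * h₁ + t * h₂ + a * hu - d * hv

/-- If `(b, x, y)` is the combination of `(b, b', p)` and `(c, c', -p')` with coefficients `s` and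
`t`, and `x` and `y` are non-negative, then `y = p`. -/
theorem eq_of_combination_of_nonneg {b b' c c' p p' s t x y : ℤ} (hc : 0 < c)
    (hb' : 0 < b') (hp : 0 < p) (hp' : 0 < p') (hbc : c < b) (hb'c' : b' < c')
    (hb : b = s * b + t * c) (hx : x = s * b' + t * c') (hy : y = s * p - t * p')
    (hx₀ : 0 ≤ x) (hy₀ : 0 ≤ y) : y = p := by
  rcases lt_trichotomy t 0 with ht | rfl | ht
  · have hs : 1 < s := by nlinarith
    have hst : s + t ≤ 0 := by
      by_contra! hpos
      nlinarith
    nlinarith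
  · have hs : s = 1 := mul_right_cancel₀ (by linarith : b ≠ 0) (by linarith)
    simp [hy, hs]
  · have hs : s < 1 := by nlinarith
    nlinarith [mul_nonneg (by linarith : 0 ≤ -s) hp.le]

/-- (Paper's Lemma 8, odd round, `b' ≠ 0`.) With `gcd(a1,a2) = 1`,
relations `b*a1 = b'*a2 + p*a3`, `c'*a2 = c*a1 + p'*a3`, determinant
`c*b' - b*c' = -a3`, `b > c` and `b' < c'`, the coefficients `p` and `p'` of `a3`
are maximal among all non-negative representations of `b*a1` and `c'*a2`. -/
theorem stmt_11 (a1 a2 a3 : ℕ) (h1 : 0 < a1) (h2 : 0 < a2) (h3 : 0 < a3)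
    (hcop : Nat.gcd a1 a2 = 1)
    (b b' c c' p p' : ℕ) (hb : 0 < b) (hb' : 0 < b') (hc : 0 < c) (hc' : 0 < c')
    (hp : 0 < p) (hp' : 0 < p')
    (e1 : b * a1 = b' * a2 + p * a3)
    (e2 : c' * a2 = c * a1 + p' * a3)
    (hdet : (c : ℤ) * b' - b * c' = -(a3 : ℤ))
    (hbc : c < b) (hb'c' : b' < c') :
    (∀ x y : ℕ, b * a1 = x * a2 + y * a3 → y ≤ p) ∧
    (∀ x y : ℕ, c' * a2 = x * a1 + y * a3 → y ≤ p') := by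
  have had : IsCoprime (a1 : ℤ) a2 := Nat.isCoprime_iff_coprime.mpr hcop
  have hm : (a3 : ℤ) ≠ 0 := by exact_mod_cast h3.ne'
  zify at hb' hc hp hp' e1 e2 hbc hb'c'
  have f2 : (c : ℤ) * a1 = c' * a2 + (-p' : ℤ) * a3 := by linear_combination -e2
  have hdet' : (b : ℤ) * c' - b' * c = a3 := by linear_combination -hdet
  constructor
  · intro x y hxy
    zify at hxy ⊢
    obtain ⟨s, t, hu, hv, hw⟩ := exists_eq_combination_of_det_eq had hm e1 f2 hdet' hxy
    exact (eq_of_combination_of_nonneg hc hb' hp hp' hbc hb'c' hu hv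
      (by linear_combination hw) x.cast_nonneg y.cast_nonneg).le
  · intro x y hxy
    zify at hxy ⊢
    obtain ⟨s, t, hu, hv, hw⟩ := exists_eq_combination_of_det_eq had hm e1 f2 hdet'
      (show (x : ℤ) * a1 = c' * a2 + (-y : ℤ) * a3 by linear_combination -hxy)
    exact (eq_of_combination_of_nonneg hb' hc hp' hp hb'c' hbc
      (s := t) (t := s) (by linear_combination hv) (by linear_combination hu)
      (by linear_combination -hw) x.cast_nonneg y.cast_nonneg).le
end

section
/- Let 0 < a_1 < a_2 < a_3 be integers with gcd(a_1, a_2) = 1, and suppose a_3 is NOT expressible as a_1·u + a_2·v with non-negative integers u, v. Let L_1 = L(a_1 | a_2, a_3) and L_2 = L(a_2 | a_1, a_3). Suppose x, y, x', y' are non-negative integers with L_1·a_1 = x·a_2 + y·a_3 and L_2·a_2 = x'·a_1 + y'·a_3, where y is maximal among all such non-negative representations of L_1·a_1 and y' is maximal among all such non-negative representations of L_2·a_2. Then G(a_1, a_2, a_3) = max(L_1·a_1 + y'·a_3, L_2·a_2 + y·a_3) = L_1·a_1 + L_2·a_2 − min(x'·a_1, x·a_2). -/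
/-- If `c` is not a non-negative combination of the coprime numbers `a`, `b`, then some multiple
`u * a` with `0 < u < b` equals `c` plus a multiple of `b`. -/
lemma exists_mul_eq_add_of_not_representable {a b c : ℕ} (hb : 0 < b) (hcop : Nat.gcd a b = 1)
    (hnr : ¬ ∃ u v : ℕ, c = a * u + b * v) :
    ∃ u v : ℕ, 0 < u ∧ u < b ∧ u * a = b * v + c * 1 := by
  have hbez : (a : ℤ) * Nat.gcdA a b + b * Nat.gcdB a b = 1 := by
    rw [← Nat.gcd_eq_gcd_ab, hcop]; rfl
  set s := Nat.gcdA a b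
  set t := Nat.gcdB a b
  have hb' : (0 : ℤ) < b := by exact_mod_cast hb
  obtain ⟨u, hu⟩ := Int.eq_ofNat_of_zero_le (Int.emod_nonneg (c * s) hb'.ne')
  have hub : (u : ℤ) < b := hu ▸ Int.emod_lt_of_pos _ hb'
  have hdiv := Int.emod_add_mul_ediv (c * s) b
  rw [hu] at hdiv
  set w := (c * s : ℤ) / b
  have hc : (c : ℤ) = a * u + b * (a * w + c * t) := by
    linear_combination (-(c : ℤ)) * hbez - (a : ℤ) * hdiv
  rcases le_or_gt 0 ((a : ℤ) * w + c * t) with h | h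
  · obtain ⟨v, hv⟩ := Int.eq_ofNat_of_zero_le h
    rw [hv] at hc
    exact absurd ⟨u, v, by exact_mod_cast hc⟩ hnr
  · obtain ⟨v, hv⟩ := Int.eq_ofNat_of_zero_le (neg_nonneg.mpr h.le)
    have hua : u * a = b * v + c * 1 := by
      zify
      linear_combination -hc + (b : ℤ) * hv
    refine ⟨u, v, Nat.pos_of_ne_zero ?_, by exact_mod_cast hub, hua⟩
    rintro rfl
    have : (0 : ℤ) < b * v := mul_pos hb' (by omega)
    have : 0 < b * v := by exact_mod_cast this
    omega

/-- In a representation of the least multiple `L * a` representable by `b` and `c`, the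
coefficient of `c` is positive when `c` is not representable by `a` and `b`. -/
lemma pos_coeff_of_isLeast {a b c L x y : ℕ} (hb : 0 < b) (hcop : Nat.gcd a b = 1)
    (hnr : ¬ ∃ u v : ℕ, c = a * u + b * v)
    (hL : IsLeast {m : ℕ | 0 < m ∧ ∃ x y : ℕ, m * a = b * x + c * y} L)
    (hxy : L * a = x * b + y * c) : 0 < y := by
  obtain ⟨u, v, hu, hub, huv⟩ := exists_mul_eq_add_of_not_representable hb hcop hnr
  have hLu : L ≤ u := hL.2 ⟨hu, v, 1, huv⟩
  refine Nat.pos_of_ne_zero ?_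
  rintro rfl
  have hdvd : b ∣ L * a := ⟨x, by rw [hxy]; ring⟩
  have := Nat.le_of_dvd hL.1.1 ((Nat.Coprime.symm hcop).dvd_of_dvd_mul_right hdvd)
  omega

/-- If `L * a` and `M * b` are least multiples, `M * b = x' * a + y' * c`, then
`L * a + y' * c` has no representation with positive coefficients. -/
lemma not_exists_pos_representation {a b c L M x' y' : ℕ} (hb : 0 < b) (hc : 0 < c)
    (hL : IsLeast {m : ℕ | 0 < m ∧ ∃ x y : ℕ, m * a = b * x + c * y} L)
    (hM : IsLeast {m : ℕ | 0 < m ∧ ∃ x y : ℕ, m * b = a * x + c * y} M)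
    (hM' : M * b = x' * a + y' * c) {p q r : ℕ} (hp : 0 < p) (hq : 0 < q) (hr : 0 < r) :
    L * a + y' * c ≠ a * p + b * q + c * r := by
  intro h
  have hrc : 0 < r * c := Nat.mul_pos hr hc
  have hqb : 0 < q * b := Nat.mul_pos hq hb
  rcases le_or_gt y' r with hry | hry
  · obtain ⟨r, rfl⟩ := Nat.exists_eq_add_of_le hry
    have hpL : p < L := by
      by_contra! hle
      have := Nat.mul_le_mul_right a hle
      nlinarith [Nat.zero_le (r * c)]
    obtain ⟨d, rfl⟩ := Nat.exists_eq_add_of_lt hpL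
    have := hL.2 (show d + 1 ∈ _ from ⟨by omega, q, r, by linarith⟩)
    omega
  obtain ⟨s, rfl⟩ := Nat.exists_eq_add_of_lt hry
  rcases le_or_gt L p with hLp | hLp
  · obtain ⟨e, rfl⟩ := Nat.exists_eq_add_of_le hLp
    have hqM : q < M := by
      by_contra! hle
      have := Nat.mul_le_mul_right b hle
      nlinarith [Nat.zero_le (e * a), Nat.zero_le (x' * a)]
    obtain ⟨d, rfl⟩ := Nat.exists_eq_add_of_lt hqM
    have := hM.2 (show d + 1 ∈ _ from ⟨by omega, x' + e, r, by linarith⟩)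
    omega
  · obtain ⟨d, rfl⟩ := Nat.exists_eq_add_of_lt hLp
    have hMq : M ≤ q := hM.2 ⟨hq, d + 1, s + 1, by linarith⟩
    obtain ⟨e, rfl⟩ := Nat.exists_eq_add_of_le hMq
    have hxd : x' < d + 1 := by
      by_contra! hle
      have := Nat.mul_le_mul_right a hle
      nlinarith [Nat.zero_le (e * b)]
    obtain ⟨f, rfl⟩ : ∃ f, d = x' + f := Nat.exists_eq_add_of_le (by omega)
    have := hL.2 (show f + 1 ∈ _ from ⟨by omega, e, r, by linarith⟩)
    omega

/-- An integer solution of `N = p * a + q * b + r * c` with `p, q > 0` can be moved to one with all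
coefficients positive, provided `N` exceeds the bound given by the relations
`L * a = x * b + y * c` and `M * b = x' * a + y' * c`. -/
lemma exists_pos_representation {a b c L M x y x' y' N : ℤ} (ha : 0 < a) (hb : 0 < b) (hc : 0 < c)
    (hxy : L * a = x * b + y * c) (hxy' : M * b = x' * a + y' * c)
    (hy : 0 < y) (hy' : 0 < y') (hx0 : 0 ≤ x) (hx0' : 0 ≤ x')
    (hN₁ : L * a + y' * c < N) (hN₂ : M * b + y * c < N) :
    ∀ (n : ℕ) (p q r : ℤ), 0 < p → 0 < q → N = a * p + b * q + c * r → a * p + b * q ≤ n →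
      ∃ p q r : ℤ, 0 < p ∧ 0 < q ∧ 0 < r ∧ N = a * p + b * q + c * r := by
  intro n
  induction n with
  | zero =>
    intro p q r hp hq _ hle
    have := mul_pos ha hp
    have := mul_pos hb hq
    push_cast at hle
    omega
  | succ n ih =>
    intro p q r hp hq hN hle
    push_cast at hle
    have hyc := mul_pos hy hc
    have hyc' := mul_pos hy' hc
    rcases lt_or_ge 0 r with hr | hr
    · exact ⟨p, q, r, hp, hq, hr, hN⟩
    have hcr : c * r ≤ 0 := mul_nonpos_of_nonneg_of_nonpos hc.le hr
    rcases lt_or_ge L p with hp' | hp'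
    · exact ih (p - L) (q + x) (r + y) (by omega) (by omega) (by linarith) (by linarith)
    rcases lt_or_ge M q with hq' | hq'
    · exact ih (p + x') (q - M) (r + y') (by omega) (by omega) (by linarith) (by linarith)
    have hpa := mul_le_mul_of_nonneg_left hp' ha.le
    have hqb := mul_le_mul_of_nonneg_left hq' hb.le
    rcases lt_or_ge (L - x') p with hp'' | hp''
    · rcases lt_or_ge (M - x) q with hq'' | hq''
      · exact ih (p - (L - x')) (q - (M - x)) (r + (y + y')) (by omega) (by omega)
          (by linarith) (by linarith)
      · have := mul_le_mul_of_nonneg_left hq'' hb.le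
        linarith
    · have := mul_le_mul_of_nonneg_left hp'' ha.le
      linarith

/-- Every integer is an integer combination of coprime `a`, `b` and of `c > 0` in which the
coefficients of `a` and `b` are positive. -/
lemma exists_int_representation {a b c : ℕ} (hc : 0 < c) (hcop : Nat.gcd a b = 1) (N : ℤ) :
    ∃ p q r : ℤ, 0 < p ∧ 0 < q ∧ N = a * p + b * q + c * r := by
  have hbez : (a : ℤ) * Nat.gcdA a b + b * Nat.gcdB a b = 1 := by
    rw [← Nat.gcd_eq_gcd_ab, hcop]; rfl
  set u := N * Nat.gcdA a b with hu
  set v := N * Nat.gcdB a b with hv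
  have hc' : (1 : ℤ) ≤ c := by exact_mod_cast hc
  have hK : |u| + |v| + 1 ≤ (|u| + |v| + 1) * c := le_mul_of_one_le_right (by positivity) hc'
  refine ⟨u + (|u| + |v| + 1) * c, v + (|u| + |v| + 1) * c, -((|u| + |v| + 1) * (a + b)),
    ?_, ?_, ?_⟩
  · linarith [neg_abs_le u, abs_nonneg v]
  · linarith [neg_abs_le v, abs_nonneg u]
  · linear_combination (-N) * hbez - (a : ℤ) * hu - (b : ℤ) * hv


/-- (Paper's Lemma 9.) For `0 < a1 < a2 < a3` with `gcd(a1,a2) = 1` and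
`a3` not a non-negative combination of `a1, a2`: if `L1 = L(a1|a2,a3)`,
`L2 = L(a2|a1,a3)`, `L1*a1 = x*a2 + y*a3` and `L2*a2 = x'*a1 + y'*a3` with `y`, `y'`
maximal, then `G(a1,a2,a3) = max(L1*a1 + y'*a3, L2*a2 + y*a3)
= L1*a1 + L2*a2 - min(x'*a1, x*a2)`. -/
theorem stmt_12 (a1 a2 a3 : ℕ) (h0 : 0 < a1) (h12 : a1 < a2) (h23 : a2 < a3)
    (hcop : Nat.gcd a1 a2 = 1)
    (hnr : ¬ ∃ u v : ℕ, a3 = a1 * u + a2 * v)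
    (L1 L2 : ℕ)
    (hL1 : IsLeast {m : ℕ | 0 < m ∧ ∃ x y : ℕ, m * a1 = a2 * x + a3 * y} L1)
    (hL2 : IsLeast {m : ℕ | 0 < m ∧ ∃ x y : ℕ, m * a2 = a1 * x + a3 * y} L2)
    (x y x' y' : ℕ)
    (hxy : L1 * a1 = x * a2 + y * a3)
    (hx'y' : L2 * a2 = x' * a1 + y' * a3)
    (hymax : ∀ x0 y0 : ℕ, L1 * a1 = x0 * a2 + y0 * a3 → y0 ≤ y)
    (hy'max : ∀ x0 y0 : ℕ, L2 * a2 = x0 * a1 + y0 * a3 → y0 ≤ y') :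
    IsGreatest {N : ℕ | 0 < N ∧ ¬ ∃ x1 x2 x3 : ℕ, 0 < x1 ∧ 0 < x2 ∧ 0 < x3 ∧
        N = a1 * x1 + a2 * x2 + a3 * x3}
      (max (L1 * a1 + y' * a3) (L2 * a2 + y * a3)) ∧
    max (L1 * a1 + y' * a3) (L2 * a2 + y * a3)
      = L1 * a1 + L2 * a2 - min (x' * a1) (x * a2) := by
  have ha : 0 < a2 := by omega
  have hc : 0 < a3 := by omega
  have hcop' : Nat.gcd a2 a1 = 1 := by rw [Nat.gcd_comm, hcop]
  have hnr' : ¬ ∃ u v : ℕ, a3 = a2 * u + a1 * v := fun ⟨u, v, h⟩ => hnr ⟨v, u, by omega⟩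
  have hy := pos_coeff_of_isLeast ha hcop hnr hL1 hxy
  have hy' := pos_coeff_of_isLeast h0 hcop' hnr' hL2 hx'y'
  refine ⟨⟨⟨?_, ?_⟩, ?_⟩, ?_⟩
  · exact lt_max_of_lt_left (Nat.add_pos_left (Nat.mul_pos hL1.1.1 h0) _)
  · rintro ⟨p, q, r, hp, hq, hr, h⟩
    rcases max_choice (L1 * a1 + y' * a3) (L2 * a2 + y * a3) with hm | hm <;> rw [hm] at h
    · exact not_exists_pos_representation ha hc hL1 hL2 hx'y' hp hq hr h
    · exact not_exists_pos_representation h0 hc hL2 hL1 hxy hq hp hr (by omega)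
  · rintro N ⟨-, hN⟩
    by_contra! hlt
    obtain ⟨hN₁, hN₂⟩ := max_lt_iff.mp hlt
    obtain ⟨p, q, r, hp, hq, h⟩ := exists_int_representation hc hcop N
    obtain ⟨p, q, r, hp, hq, hr, h⟩ := exists_pos_representation (a := a1) (b := a2) (c := a3)
      (L := L1) (M := L2) (x := x) (y := y) (x' := x') (y' := y') (N := N)
      (by omega) (by omega) (by omega) (by exact_mod_cast hxy) (by exact_mod_cast hx'y')
      (by omega) (by omega) (by omega) (by omega) (by exact_mod_cast hN₁) (by exact_mod_cast hN₂)
      (a1 * p + a2 * q).toNat p q r hp hq h (Int.self_le_toNat _)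
    lift p to ℕ using hp.le
    lift q to ℕ using hq.le
    lift r to ℕ using hr.le
    exact hN ⟨p, q, r, by omega, by omega, by omega, by exact_mod_cast h⟩
  · omega
end

section
/- Let 0 < a_1 < a_2 < a_3 be integers with gcd(a_1, a_2) = 1, and suppose a_3 is NOT expressible as a_1·u + a_2·v with non-negative integers u, v. Then L(a_1 | a_2, a_3) < a_2 and L(a_2 | a_1, a_3) < a_1; moreover, in every representation L(a_1 | a_2, a_3)·a_1 = x·a_2 + y·a_3 with non-negative integers x, y one has y > 0, and in every representation L(a_2 | a_1, a_3)·a_2 = x'·a_1 + y'·a_3 with non-negative integers x', y' one has y' > 0. -/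
/-- If `c` is not a non-negative combination of the coprime numbers `a`, `b`, then some multiple
`u * a` with `0 < u < b` exceeds `c` by a multiple of `b`. -/
theorem exists_mul_eq_mul_add_of_not_representable {a b c : ℕ} (ha : 0 < a) (hb : 0 < b)
    (hcop : Nat.Coprime a b) (hnr : ¬ ∃ u v : ℕ, c = a * u + b * v) :
    ∃ u v : ℕ, 0 < u ∧ u < b ∧ u * a = b * v + c := by
  obtain ⟨k, hk0, hkc⟩ := Nat.chineseRemainder hcop 0 c
  have hk : k % (a * b) ≡ c [MOD b] := ((Nat.mod_modEq k (a * b)).of_mul_left a).trans hkc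
  have hdvd : a ∣ k % (a * b) :=
    (Nat.dvd_mod_iff (Nat.dvd_mul_right a b)).2 ((Nat.modEq_zero_iff_dvd).1 hk0)
  obtain ⟨u, hu⟩ := hdvd
  have hub : u < b := by
    have : a * u < a * b := hu ▸ Nat.mod_lt _ (Nat.mul_pos ha hb)
    exact Nat.lt_of_mul_lt_mul_left this
  rw [hu] at hk
  rcases le_total (a * u) c with hle | hle
  · obtain ⟨v, hv⟩ := (Nat.modEq_iff_dvd' hle).1 hk
    exact (hnr ⟨u, v, by omega⟩).elim
  · obtain ⟨v, hv⟩ := (Nat.modEq_iff_dvd' hle).1 hk.symm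
    refine ⟨u, v, Nat.pos_of_ne_zero ?_, hub, by rw [mul_comm u a]; omega⟩
    rintro rfl
    exact hnr ⟨0, 0, by omega⟩

theorem isLeast_lt_and_coeff_pos {a b c m : ℕ} (ha : 0 < a) (hb : 0 < b)
    (hcop : Nat.Coprime a b) (hnr : ¬ ∃ u v : ℕ, c = a * u + b * v)
    (hm : IsLeast {m : ℕ | 0 < m ∧ ∃ x y : ℕ, m * a = b * x + c * y} m) :
    m < b ∧ ∀ x y : ℕ, m * a = x * b + y * c → 0 < y := by
  obtain ⟨u, v, hu, hub, huv⟩ := exists_mul_eq_mul_add_of_not_representable ha hb hcop hnr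
  have hmb : m < b := (hm.2 ⟨hu, v, 1, by rw [huv, mul_one]⟩).trans_lt hub
  refine ⟨hmb, fun x y hxy => Nat.pos_of_ne_zero ?_⟩
  rintro rfl
  have hdvd : b ∣ m * a := ⟨x, by rw [hxy]; ring⟩
  exact absurd (Nat.le_of_dvd hm.1.1 (hcop.symm.dvd_of_dvd_mul_right hdvd)) hmb.not_ge


/-- For `0 < a1 < a2 < a3` with `gcd(a1,a2) = 1` and `a3` not a
non-negative combination of `a1, a2`: `L(a1|a2,a3) < a2`, `L(a2|a1,a3) < a1`, and in
every non-negative representation of `L(a1|a2,a3)*a1` (resp. `L(a2|a1,a3)*a2`) the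
coefficient of `a3` is positive. -/
theorem stmt_13 (a1 a2 a3 : ℕ) (h0 : 0 < a1) (h12 : a1 < a2) (h23 : a2 < a3)
    (hcop : Nat.gcd a1 a2 = 1)
    (hnr : ¬ ∃ u v : ℕ, a3 = a1 * u + a2 * v)
    (L1 L2 : ℕ)
    (hL1 : IsLeast {m : ℕ | 0 < m ∧ ∃ x y : ℕ, m * a1 = a2 * x + a3 * y} L1)
    (hL2 : IsLeast {m : ℕ | 0 < m ∧ ∃ x y : ℕ, m * a2 = a1 * x + a3 * y} L2) :
    L1 < a2 ∧ L2 < a1 ∧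
    (∀ x y : ℕ, L1 * a1 = x * a2 + y * a3 → 0 < y) ∧
    (∀ x' y' : ℕ, L2 * a2 = x' * a1 + y' * a3 → 0 < y') := by
  have ha2 : 0 < a2 := h0.trans h12
  have h1 := isLeast_lt_and_coeff_pos h0 ha2 hcop hnr hL1
  have h2 := isLeast_lt_and_coeff_pos ha2 h0 (Nat.Coprime.symm hcop)
    (fun ⟨u, v, h⟩ => hnr ⟨v, u, by rw [h, add_comm]⟩) hL2
  exact ⟨h1.1, h2.1, h1.2, h2.2⟩
end

section
/- Let 0 < a_1 < a_2 < a_3 be integers with gcd(a_1, a_2) = 1, with a_3 not expressible as a non-negative integer combination of a_1 and a_2. Let L_1 = L(a_1 | a_2, a_3), L_2 = L(a_2 | a_1, a_3), and let y (respectively y') be the maximal non-negative integer occurring as the coefficient of a_3 in a representation L_1·a_1 = x·a_2 + y·a_3 (respectively L_2·a_2 = x'·a_1 + y'·a_3) with non-negative integer coefficients. Suppose N is a positive integer such that N is NOT expressible as a_1·x_1 + a_2·x_2 + a_3·x_3 with positive integers x_1, x_2, x_3, but N is expressible as z·a_2 + z'·a_3, as t·a_1 + t'·a_3, and as w·a_1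 + w'·a_2, each with positive integer coefficients. Then N = L_1·a_1 + y'·a_3 or N = L_2·a_2 + y·a_3. -/
/-- If `a`, `b` are coprime and `c` is not a non-negative combination of them, then `a * b - c` is
a positive combination of `a` and `b`. -/
theorem Nat.Coprime.exists_mul_eq_add_of_not_exists {a b c : ℕ} (ha : 0 < a) (hb : 0 < b)
    (hab : a.Coprime b) (hc : ¬ ∃ u v : ℕ, c = a * u + b * v) :
    ∃ i j : ℕ, 0 < i ∧ 0 < j ∧ a * b = i * a + j * b + c := by
  obtain ⟨k, hk0, hkc, hlt⟩ : ∃ k, k ≡ 0 [MOD a] ∧ k ≡ c [MOD b] ∧ k < a * b :=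
    ⟨Nat.chineseRemainder hab 0 c, (Nat.chineseRemainder hab 0 c).2.1,
      (Nat.chineseRemainder hab 0 c).2.2,
      Nat.chineseRemainder_lt_mul hab 0 c ha.ne' hb.ne'⟩
  obtain ⟨u, rfl⟩ := (Nat.modEq_zero_iff_dvd).1 hk0
  have hub : u < b := Nat.lt_of_mul_lt_mul_left hlt
  rcases le_or_gt (a * u) c with h | h
  · obtain ⟨v, hv⟩ := (Nat.modEq_iff_dvd' h).1 hkc
    exact absurd ⟨u, v, by omega⟩ hc
  · obtain ⟨j, hj⟩ := (Nat.modEq_iff_dvd' h.le).1 hkc.symm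
    obtain ⟨i, rfl⟩ := Nat.exists_eq_add_of_lt hub
    refine ⟨i + 1, j, by omega, Nat.pos_of_ne_zero ?_, ?_⟩
    · rintro rfl
      omega
    · have : a * u = (u + i + 1) * j + c := by omega
      linarith

/-- The least positive multiple `L * b` lying in `⟨a, c⟩` is not a multiple of `a`, when `a`, `b`
are coprime and `c` is not in `⟨a, b⟩`. -/
theorem coeff_pos_of_minimal {a b c L x y : ℕ} (ha : 0 < a) (hb : 0 < b)
    (hab : a.Coprime b) (hc : ¬ ∃ u v : ℕ, c = a * u + b * v) (hL : 0 < L)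
    (hmin : ∀ m p q, 0 < m → m * b = p * a + q * c → L ≤ m)
    (h : L * b = x * a + y * c) : 0 < y := by
  obtain ⟨i, j, hi, hj, hij⟩ := hab.exists_mul_eq_add_of_not_exists ha hb hc
  refine Nat.pos_of_ne_zero ?_
  rintro rfl
  have hle : a ≤ L := Nat.le_of_dvd hL (hab.dvd_of_dvd_mul_right ⟨x, by linarith⟩)
  have hja : j < a := by
    by_contra! hcon
    have := Nat.mul_le_mul_right b hcon
    have := Nat.mul_pos hi ha
    omega
  obtain ⟨k, rfl⟩ := Nat.exists_eq_add_of_lt hja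
  have := hmin (k + 1) i 1 (by omega) (by linarith)
  omega

section

variable {a b c L₁ L₂ x y x' y' N z z' t t' w w' : ℕ}

theorem eq_of_coeffs_eq_zero
    (m₁ : ∀ m p q, 0 < m → m * a = p * b + q * c → L₁ ≤ m)
    (m₂ : ∀ m p q, 0 < m → m * b = p * a + q * c → L₂ ≤ m)
    (e₁ : L₁ * a = y * c) (e₂ : L₂ * b = y' * c) (hy : 0 < y) (hy' : 0 < y')
    (hN : ∀ p q r, 0 < p → 0 < q → 0 < r → N ≠ p * a + q * b + r * c)
    (h₁ : N = z * b + z' * c) (h₂ : N = t * a + t' * c) (h₃ : N = w * a + w' * b)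
    (hw : 0 < w) (hw' : 0 < w') (ht : L₁ ≤ t) (hz : L₂ ≤ z) :
    N = L₁ * a + y' * c := by
  have hwL : w ≤ L₁ := by
    by_contra! h
    obtain ⟨k, rfl⟩ := Nat.exists_eq_add_of_lt h
    exact hN (k + 1) w' y (by omega) hw' hy (by linarith)
  have hwL' : w' ≤ L₂ := by
    by_contra! h
    obtain ⟨k, rfl⟩ := Nat.exists_eq_add_of_lt h
    exact hN w (k + 1) y' hw (by omega) hy' (by linarith)
  obtain ⟨k, rfl⟩ := Nat.exists_eq_add_of_le (hwL.trans ht)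
  have := m₂ w' k t' hw' (by linarith)
  obtain rfl : w' = L₂ := by omega
  obtain ⟨l, rfl⟩ := Nat.exists_eq_add_of_le hz
  have := m₁ w l z' hw (by linarith)
  obtain rfl : w = L₁ := by omega
  linarith

theorem eq_or_eq_of_coeff_eq_zero (hc : 0 < c)
    (m₁ : ∀ m p q, 0 < m → m * a = p * b + q * c → L₁ ≤ m)
    (m₂ : ∀ m p q, 0 < m → m * b = p * a + q * c → L₂ ≤ m)
    (e₁ : L₁ * a = y * c) (e₂ : L₂ * b = x' * a + y' * c) (hy : 0 < y) (hy' : 0 < y')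
    (hL₁ : 0 < L₁)
    (hN : ∀ p q r, 0 < p → 0 < q → 0 < r → N ≠ p * a + q * b + r * c)
    (h₁ : N = z * b + z' * c) (h₂ : N = t * a + t' * c) (h₃ : N = w * a + w' * b)
    (hz : 0 < z) (hz' : 0 < z') (hw : 0 < w) (hw' : 0 < w')
    (ht : L₁ ≤ t) :
    N = L₁ * a + y' * c ∨ N = L₂ * b + y * c := by
  have hzy : z' ≤ y := by
    by_contra! h
    obtain ⟨k, rfl⟩ := Nat.exists_eq_add_of_lt h
    exact hN L₁ z (k + 1) hL₁ hz (by omega) (by linarith)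
  obtain ⟨s, rfl⟩ := Nat.exists_eq_add_of_le ht
  obtain ⟨d, rfl⟩ := Nat.exists_eq_add_of_le hzy
  have hzL := m₂ z s (t' + d) hz (by linarith)
  rcases hzL.lt_or_eq with hlt | rfl
  · obtain ⟨k, rfl⟩ := Nat.exists_eq_add_of_lt hlt
    rcases Nat.eq_zero_or_pos x' with rfl | hx'
    · exact .inl <| eq_of_coeffs_eq_zero m₁ m₂ e₁ (by linarith) hy hy' hN h₁ h₂ h₃ hw hw' ht hzL
    · exact absurd (by linarith) (hN x' (k + 1) (y' + z') hx' (by omega) (by omega))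
  rcases Nat.eq_zero_or_pos d with rfl | hd
  · exact .inr (by linarith)
  exfalso
  have hdc := Nat.mul_pos hd hc
  rcases lt_trichotomy w' L₂ with h | rfl | h
  · obtain ⟨k, rfl⟩ := Nat.exists_eq_add_of_lt h
    have hwL := m₁ w (k + 1) z' hw (by linarith)
    rcases hwL.lt_or_eq with hlt | rfl
    · obtain ⟨l, rfl⟩ := Nat.exists_eq_add_of_lt hlt
      exact hN (l + 1) w' (z' + d) (by omega) hw' hy (by linarith)
    · have := m₂ w' s t' hw' (by linarith)
      omega
  · have := m₁ w 0 z' hw (by linarith)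
    have := Nat.mul_le_mul_right a this
    linarith
  · obtain ⟨k, rfl⟩ := Nat.exists_eq_add_of_lt h
    exact hN (w + x') (k + 1) y' (by omega) (by omega) hy' (by linarith)

theorem eq_or_eq_of_lt (hc : 0 < c)
    (m₁ : ∀ m p q, 0 < m → m * a = p * b + q * c → L₁ ≤ m)
    (m₂ : ∀ m p q, 0 < m → m * b = p * a + q * c → L₂ ≤ m)
    (e₁ : L₁ * a = x * b + y * c) (e₂ : L₂ * b = x' * a + y' * c)
    (M₁ : ∀ p q, L₁ * a = p * b + q * c → q ≤ y)
    (M₂ : ∀ p q, L₂ * b = p * a + q * c → q ≤ y')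
    (hy : 0 < y) (hy' : 0 < y') (hL₁ : 0 < L₁)
    (hN : ∀ p q r, 0 < p → 0 < q → 0 < r → N ≠ p * a + q * b + r * c)
    (h₁ : N = z * b + z' * c) (h₂ : N = t * a + t' * c) (h₃ : N = w * a + w' * b)
    (hz : 0 < z) (ht : 0 < t) (ht' : 0 < t') (hw : 0 < w) (hw' : 0 < w')
    (hlt : t' < z') :
    N = L₁ * a + y' * c ∨ N = L₂ * b + y * c := by
  obtain ⟨d, rfl⟩ := Nat.exists_eq_add_of_lt hlt
  have htL := m₁ t z (d + 1) ht (by linarith)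
  rcases Nat.eq_zero_or_pos x with rfl | hx
  · exact eq_or_eq_of_coeff_eq_zero hc m₁ m₂ (by linarith) e₂ hy hy' hL₁ hN h₁ h₂ h₃ hz
      (by omega) hw hw' htL
  rcases htL.lt_or_eq with h | rfl
  · obtain ⟨k, rfl⟩ := Nat.exists_eq_add_of_lt h
    exact absurd (by linarith) (hN (k + 1) x (y + t') (by omega) hx (by omega))
  left
  rcases lt_trichotomy w L₁ with hwL | rfl | hwL
  · obtain ⟨s, rfl⟩ := Nat.exists_eq_add_of_lt hwL
    have hwL' := m₂ w' (s + 1) t' hw' (by linarith)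
    rcases hwL'.lt_or_eq with h | rfl
    · obtain ⟨k, rfl⟩ := Nat.exists_eq_add_of_lt h
      exact absurd (by linarith) (hN (w + x') (k + 1) y' (by omega) (by omega) hy')
    have hty := M₂ (s + 1) t' (by linarith)
    obtain ⟨f, rfl⟩ := Nat.exists_eq_add_of_le hty
    rcases Nat.eq_zero_or_pos f with rfl | hf
    · simpa using h₂
    exfalso
    have hfc := Nat.mul_pos hf hc
    have hxs : x' < s + 1 := by
      by_contra! h
      have := Nat.mul_le_mul_right a h
      linarith
    obtain ⟨g, hg⟩ := Nat.exists_eq_add_of_lt hxs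
    obtain rfl : s = x' + g := by omega
    have hx' : 0 < x' := by
      refine Nat.pos_of_ne_zero ?_
      rintro rfl
      have := m₁ (g + 1) 0 f (by omega) (by linarith)
      omega
    have hzw : z ≤ L₂ := by
      by_contra! h
      obtain ⟨k, rfl⟩ := Nat.exists_eq_add_of_lt h
      exact hN x' (k + 1) (t' + f + (t' + d + 1)) hx' (by omega) (by omega) (by linarith)
    rcases le_or_gt f (d + 1) with hfd | hfd
    · obtain ⟨r, hr⟩ := Nat.exists_eq_add_of_le hfd
      have hr' : (d + 1) * c = (f + r) * c := by rw [hr]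
      have := m₁ (w + x') z r (by omega) (by linarith)
      omega
    · obtain ⟨r, rfl⟩ := Nat.exists_eq_add_of_lt hfd
      have := m₂ z (w + x') (r + 1) hz (by linarith)
      obtain rfl : z = L₂ := by omega
      have := m₁ w 0 (t' + d + 1) hw (by linarith)
      omega
  · have hwL' := m₂ w' 0 t' hw' (by linarith)
    rcases le_or_gt y' t' with h | h
    · obtain ⟨k, rfl⟩ := Nat.exists_eq_add_of_le h
      obtain ⟨l, rfl⟩ := Nat.exists_eq_add_of_le hwL'
      rcases Nat.eq_zero_or_pos l with rfl | hl
      · have := M₂ 0 (y' + k) (by linarith)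
        obtain rfl : k = 0 := by omega
        simpa using h₂
      · exact absurd (by linarith) (hN (w + x') l y' (by omega) hl hy')
    · have := Nat.mul_le_mul_right b hwL'
      have := Nat.mul_lt_mul_of_pos_right h hc
      have := Nat.zero_le (x' * a)
      linarith
  · obtain ⟨k, rfl⟩ := Nat.exists_eq_add_of_lt hwL
    exact absurd (by linarith) (hN (k + 1) (w' + x) y (by omega) (by omega) hy)

end


/-- For `0 < a1 < a2 < a3` with `gcd(a1,a2) = 1` and `a3` not a
non-negative combination of `a1, a2`, with `L1, L2, y, y'` as in the paper's Lemma 9: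
if a positive integer `N` is not a positive combination of all three of `a1, a2, a3`
but is a positive combination of each pair, then `N = L1*a1 + y'*a3` or
`N = L2*a2 + y*a3`. -/
theorem stmt_14 (a1 a2 a3 : ℕ) (h0 : 0 < a1) (h12 : a1 < a2) (h23 : a2 < a3)
    (hcop : Nat.gcd a1 a2 = 1)
    (hnr : ¬ ∃ u v : ℕ, a3 = a1 * u + a2 * v)
    (L1 L2 : ℕ)
    (hL1 : IsLeast {m : ℕ | 0 < m ∧ ∃ x y : ℕ, m * a1 = a2 * x + a3 * y} L1)
    (hL2 : IsLeast {m : ℕ | 0 < m ∧ ∃ x y : ℕ, m * a2 = a1 * x + a3 * y} L2)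
    (x y x' y' : ℕ)
    (hxy : L1 * a1 = x * a2 + y * a3)
    (hx'y' : L2 * a2 = x' * a1 + y' * a3)
    (hymax : ∀ x0 y0 : ℕ, L1 * a1 = x0 * a2 + y0 * a3 → y0 ≤ y)
    (hy'max : ∀ x0 y0 : ℕ, L2 * a2 = x0 * a1 + y0 * a3 → y0 ≤ y')
    (N : ℕ) (hN : 0 < N)
    (hNnot : ¬ ∃ x1 x2 x3 : ℕ, 0 < x1 ∧ 0 < x2 ∧ 0 < x3 ∧
      N = a1 * x1 + a2 * x2 + a3 * x3)
    (hN23 : ∃ z z' : ℕ, 0 < z ∧ 0 < z' ∧ N = z * a2 + z' * a3)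
    (hN13 : ∃ t t' : ℕ, 0 < t ∧ 0 < t' ∧ N = t * a1 + t' * a3)
    (hN12 : ∃ w w' : ℕ, 0 < w ∧ 0 < w' ∧ N = w * a1 + w' * a2) :
    N = L1 * a1 + y' * a3 ∨ N = L2 * a2 + y * a3 := by
  obtain ⟨z, z', hz, hz', h₁⟩ := hN23
  obtain ⟨t, t', ht, ht', h₂⟩ := hN13
  obtain ⟨w, w', hw, hw', h₃⟩ := hN12
  have hb : 0 < a2 := by omega
  have hc : 0 < a3 := by omega
  have hcop' : Nat.Coprime a1 a2 := hcop
  have hnr' : ¬ ∃ u v : ℕ, a3 = a2 * u + a1 * v := fun ⟨u, v, h⟩ => hnr ⟨v, u, by linarith⟩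
  have m₁ : ∀ m p q, 0 < m → m * a1 = p * a2 + q * a3 → L1 ≤ m :=
    fun m p q hm h => hL1.2 ⟨hm, p, q, by linarith⟩
  have m₂ : ∀ m p q, 0 < m → m * a2 = p * a1 + q * a3 → L2 ≤ m :=
    fun m p q hm h => hL2.2 ⟨hm, p, q, by linarith⟩
  have hy := coeff_pos_of_minimal hb h0 hcop'.symm hnr' hL1.1.1 m₁ hxy
  have hy' := coeff_pos_of_minimal h0 hb hcop' hnr hL2.1.1 m₂ hx'y'
  have hN' : ∀ p q r, 0 < p → 0 < q → 0 < r → N ≠ p * a1 + q * a2 + r * a3 :=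
    fun p q r hp hq hr h => hNnot ⟨p, q, r, hp, hq, hr, by linarith⟩
  rcases lt_trichotomy t' z' with h | rfl | h
  · exact eq_or_eq_of_lt hc m₁ m₂ hxy hx'y' hymax hy'max hy hy' hL1.1.1 hN' h₁ h₂ h₃
      hz ht ht' hw hw' h
  · exfalso
    obtain ⟨i, j, hi, hj, hij⟩ := hcop'.exists_mul_eq_add_of_not_exists h0 hb hnr
    obtain ⟨k, rfl⟩ : a2 ∣ t := hcop'.symm.dvd_of_dvd_mul_right ⟨z, by linarith⟩
    obtain ⟨l, rfl⟩ := Nat.exists_eq_add_of_lt (Nat.pos_of_mul_pos_left ht)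
    refine hN' (i + a2 * l) j (1 + t') (by omega) hj (by omega) ?_
    linarith
  · exact (eq_or_eq_of_lt hc m₂ m₁ hx'y' hxy hy'max hymax hy' hy hL2.1.1
      (fun p q r hp hq hr h => hN' q p r hq hp hr (by linarith)) h₂ h₁ (by linarith)
      ht hz hz' hw' hw h).symm
end

section
/- Let 0 < a_1 < a_2 < a_3 be integers with gcd(a_1, a_2) = 1 and with a_3 not expressible as a non-negative integer combination of a_1 and a_2. Suppose b, c, c', p, p' are positive integers and b' is a non-negative integer such that: b·a_1 = b'·a_2 + p·a_3; c'·a_2 = c·a_1 + p'·a_3; c·b' − b·c' = −a_3; and either b' = 0, or both b > c and b' < c'. Then G(a_1, a_2, a_3) = b·a_1 + c'·a_2 − min(c·a_1, b'·a_2). -/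
/-- The integer solutions of `a1 * u + a2 * v = a3 * t` are spanned by the two given relations
when their determinant is `a3`. -/
theorem exists_coords_of_relations {a1 a2 a3 b b' c c' p p' u v t : ℤ} (h3 : 0 < a3)
    (hcop : IsCoprime a1 a2) (e1 : b * a1 = b' * a2 + p * a3) (e2 : c' * a2 = c * a1 + p' * a3)
    (hdet : c * b' - b * c' = -a3) (h : a1 * u + a2 * v = a3 * t) :
    ∃ i j : ℤ, u = i * b - j * c ∧ v = j * c' - i * b' ∧ t = i * p + j * p' := by
  obtain ⟨α, β, hαβ⟩ := hcop
  obtain ⟨i, hi⟩ : a3 ∣ u * c' + v * c :=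
    ⟨α * (c' * t - p' * v) + β * (c * t + u * p'), by
      linear_combination (-(u * c' + v * c)) * hαβ + (α * c' + β * c) * h
        + (β * u - α * v) * e2⟩
  obtain ⟨j, hj⟩ : a3 ∣ u * b' + v * b :=
    ⟨α * (b' * t + p * v) + β * (b * t - u * p), by
      linear_combination (-(u * b' + v * b)) * hαβ + (α * b' + β * b) * h
        + (α * v - β * u) * e1⟩
  refine ⟨i, j, ?_, ?_, ?_⟩
  · apply mul_left_cancel₀ h3.ne'
    linear_combination b * hi - c * hj + u * hdet
  · apply mul_left_cancel₀ h3.ne'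
    linear_combination c' * hj - b' * hi + v * hdet
  · apply mul_left_cancel₀ (mul_pos h3 h3).ne'
    linear_combination (-a3) * h + (a1 * u + a2 * v) * hdet + (p * a3) * hi + (p' * a3) * hj
      + (u * c' + v * c) * e1 + (u * b' + v * b) * e2

/-- A positive combination of the two relations is not dominated by the corner
`(b - 1, c' - b' - 1)`. -/
theorem not_dominated_fst {b b' c c' p p' i j : ℤ} (hc : 0 < c)
    (hc' : 0 < c') (hb' : 0 ≤ b') (hp : 0 < p) (hp' : 0 < p')
    (hcase : b' = 0 ∧ 0 < b ∨ c < b ∧ b' < c')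
    (ht : 0 < i * p + j * p') (hu : i * b - j * c < b) (hv : j * c' - i * b' < c' - b') : False := by
  rcases hcase with ⟨rfl, hb⟩ | ⟨hcb, hbc⟩
  · have hj : j ≤ 0 := by by_contra! h; nlinarith
    have hi : 1 ≤ i := by by_contra! h; nlinarith
    nlinarith
  · rcases le_or_gt i 0 with hi | hi
    · have hj : 1 ≤ j := by by_contra! h; nlinarith
      nlinarith
    · have hj : i ≤ j := by by_contra! h; nlinarith
      nlinarith

/-- A positive combination of the two relations is not dominated by the corner
`(b - c - 1, c' - 1)`. -/
theorem not_dominated_snd {b b' c c' p p' i j : ℤ} (hc : 0 < c)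
    (hb' : 0 ≤ b') (hp : 0 < p) (hp' : 0 < p') (hcb : c < b) (hbc : b' < c')
    (ht : 0 < i * p + j * p') (hu : i * b - j * c < b - c) (hv : j * c' - i * b' < c') : False := by
  rcases le_or_gt j 0 with hj | hj
  · have hi : 1 ≤ i := by by_contra! h; nlinarith
    nlinarith
  · have hi : 1 ≤ i := by by_contra! h; nlinarith
    have hij : i < j := by by_contra! h; nlinarith
    nlinarith

/-- Every residue modulo `a3` is attained by a positive combination of `a1`, `a2` whose
coefficients lie in the L-shaped region determined by the two relations. -/
theorem exists_mem_lShape {a1 a2 a3 b b' c c' p p' : ℤ} (h1 : 0 < a1) (h2 : 0 < a2) (h3 : 0 < a3)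
    (hcop : IsCoprime a1 a2) (hc : 0 ≤ c) (hb' : 0 ≤ b') (hp : 0 < p) (hp' : 0 < p')
    (e1 : b * a1 = b' * a2 + p * a3) (e2 : c' * a2 = c * a1 + p' * a3) (M : ℤ) :
    ∃ x y z : ℤ, 0 < x ∧ 0 < y ∧ M = a1 * x + a2 * y + a3 * z ∧ x ≤ b ∧ y ≤ c' ∧
      (x ≤ b - c ∨ y ≤ c' - b') := by
  let P : ℕ → Prop := fun w ↦
    ∃ x y z : ℤ, 0 < x ∧ 0 < y ∧ M = a1 * x + a2 * y + a3 * z ∧ (w : ℤ) = a1 * x + a2 * y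
  have hP : ∃ w, P w := by
    obtain ⟨α, β, hαβ⟩ := hcop
    set s := |M * α| + 1
    set r := |M * β| + 1
    have hx : 0 < M * α + a3 * s := by
      have := neg_abs_le (M * α)
      have := abs_nonneg (M * α)
      nlinarith
    have hy : 0 < M * β + a3 * r := by
      have := neg_abs_le (M * β)
      have := abs_nonneg (M * β)
      nlinarith
    refine ⟨(a1 * (M * α + a3 * s) + a2 * (M * β + a3 * r)).toNat, M * α + a3 * s,
      M * β + a3 * r, -(a1 * s + a2 * r), hx, hy, ?_, Int.toNat_of_nonneg (by positivity)⟩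
    linear_combination (-M) * hαβ
  classical
  obtain ⟨x, y, z, hx, hy, hM, hw⟩ := Nat.find_spec hP
  have key : ∀ x' y' k : ℤ, 0 < x' → 0 < y' → 0 < k →
      a1 * x + a2 * y = a1 * x' + a2 * y' + k * a3 → False := by
    intro x' y' k hx' hy' hk h
    have h0 : 0 < a1 * x' + a2 * y' := by positivity
    have h4 : 0 < k * a3 := by positivity
    refine Nat.find_min hP (m := (a1 * x' + a2 * y').toNat) (by omega)
      ⟨x', y', z + k, hx', hy', ?_, Int.toNat_of_nonneg h0.le⟩
    linear_combination hM + h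
  refine ⟨x, y, z, hx, hy, hM, ?_, ?_, ?_⟩
  · by_contra! h
    exact key (x - b) (y + b') p (by omega) (by omega) hp (by linear_combination e1)
  · by_contra! h
    exact key (x + c) (y - c') p' (by omega) (by omega) hp' (by linear_combination e2)
  · by_contra! h
    exact key (x - (b - c)) (y - (c' - b')) (p + p') (by omega) (by omega) (by omega)
      (by linear_combination e1 + e2)


/-- (Paper's Theorem 10, odd round.) For `0 < a1 < a2 < a3` with
`gcd(a1,a2) = 1` and `a3` not a non-negative combination of `a1, a2`, given relations
`b*a1 = b'*a2 + p*a3`, `c'*a2 = c*a1 + p'*a3`, determinant `c*b' - b*c' = -a3`, and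
either `b' = 0` or (`b > c` and `b' < c'`), one has
`G(a1,a2,a3) = b*a1 + c'*a2 - min(c*a1, b'*a2)`. -/
theorem stmt_15 (a1 a2 a3 : ℕ) (h0 : 0 < a1) (h12 : a1 < a2) (h23 : a2 < a3)
    (hcop : Nat.gcd a1 a2 = 1)
    (hnr : ¬ ∃ u v : ℕ, a3 = a1 * u + a2 * v)
    (b b' c c' p p' : ℕ) (hb : 0 < b) (hc : 0 < c) (hc' : 0 < c')
    (hp : 0 < p) (hp' : 0 < p')
    (e1 : b * a1 = b' * a2 + p * a3)
    (e2 : c' * a2 = c * a1 + p' * a3)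
    (hdet : (c : ℤ) * b' - b * c' = -(a3 : ℤ))
    (hcase : b' = 0 ∨ (c < b ∧ b' < c')) :
    IsGreatest {N : ℕ | 0 < N ∧ ¬ ∃ x1 x2 x3 : ℕ, 0 < x1 ∧ 0 < x2 ∧ 0 < x3 ∧
        N = a1 * x1 + a2 * x2 + a3 * x3}
      (b * a1 + c' * a2 - min (c * a1) (b' * a2)) := by
  have h1 : (0 : ℤ) < a1 := by exact_mod_cast h0
  have h2 : (0 : ℤ) < a2 := by omega
  have h3 : (0 : ℤ) < a3 := by omega
  have hcopZ : IsCoprime (a1 : ℤ) a2 := Nat.isCoprime_iff_coprime.mpr hcop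
  have e1Z : (b : ℤ) * a1 = b' * a2 + p * a3 := by exact_mod_cast e1
  have e2Z : (c' : ℤ) * a2 = c * a1 + p' * a3 := by exact_mod_cast e2
  have hmin : min (c * a1) (b' * a2) < b * a1 + c' * a2 := by
    have : 0 < p * a3 := Nat.mul_pos hp (by omega)
    have := min_le_right (c * a1) (b' * a2)
    omega
  obtain ⟨N, hN⟩ : ∃ N, N = b * a1 + c' * a2 - min (c * a1) (b' * a2) := ⟨_, rfl⟩
  have hNfst : (b * a1 + c' * a2 : ℤ) - b' * a2 ≤ N := by
    have := min_le_right (c * a1) (b' * a2)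
    zify at *
    omega
  have hNsnd : (b * a1 + c' * a2 : ℤ) - c * a1 ≤ N := by
    have := min_le_left (c * a1) (b' * a2)
    zify at *
    omega
  rw [← hN]
  refine ⟨⟨by omega, ?_⟩, ?_⟩
  · rintro ⟨x, y, z, hx, hy, hz, h⟩
    have hZ : (N : ℤ) = a1 * x + a2 * y + a3 * z := by exact_mod_cast h
    rcases le_total (b' * a2) (c * a1) with hle | hle
    · have hNeq : (N : ℤ) = b * a1 + c' * a2 - b' * a2 := by
        rw [min_eq_right hle] at hN hmin
        zify at *
        omega
      obtain ⟨i, j, hu, hv, ht⟩ := exists_coords_of_relations (u := b - x) (v := c' - b' - y)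
        (t := z) h3 hcopZ e1Z e2Z hdet (by linear_combination hZ - hNeq)
      exact not_dominated_fst (b := b) (b' := b') (c := c) (c' := c') (p := p) (p' := p')
        (i := i) (j := j) (by omega) (by omega) (by omega) (by omega) (by omega) (by omega)
        (by omega) (by omega) (by omega)
    · have hNeq : (N : ℤ) = b * a1 + c' * a2 - c * a1 := by
        rw [min_eq_left hle] at hN hmin
        zify at *
        omega
      have hb'0 : b' ≠ 0 := by
        rintro rfl
        have := Nat.mul_pos hc h0
        omega
      obtain ⟨i, j, hu, hv, ht⟩ := exists_coords_of_relations (u := b - c - x) (v := c' - y)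
        (t := z) h3 hcopZ e1Z e2Z hdet (by linear_combination hZ - hNeq)
      exact not_dominated_snd (b := b) (b' := b') (c := c) (c' := c') (p := p) (p' := p')
        (i := i) (j := j) (by omega) (by omega) (by omega) (by omega) (by omega) (by omega)
        (by omega) (by omega) (by omega)
  · rintro M ⟨-, hM⟩
    by_contra! hlt
    obtain ⟨x, y, z, hx, hy, hMxy, hxb, hyc, hL⟩ := exists_mem_lShape h1 h2 h3 hcopZ
      (Nat.cast_nonneg c) (Nat.cast_nonneg b') (Nat.cast_pos.mpr hp) (Nat.cast_pos.mpr hp')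
      e1Z e2Z M
    have hle : a1 * x + a2 * y ≤ N := by
      rcases hL with hL | hL
      · nlinarith
      · nlinarith
    have hz : 0 < z := by
      have : (N : ℤ) < M := by exact_mod_cast hlt
      by_contra! h
      nlinarith
    lift x to ℕ using hx.le
    lift y to ℕ using hy.le
    lift z to ℕ using hz.le
    exact hM ⟨x, y, z, by exact_mod_cast hx, by exact_mod_cast hy, by exact_mod_cast hz,
      by exact_mod_cast hMxy⟩
end

section
/- Let a and d be positive integers with gcd(a, d) = 1 and a ≥ 3. Then g(a, a+d, a+2d) = ⌊(a−2)/2⌋·a + (a−1)·d, i.e., the largest integer not expressible as a·x_1 + (a+d)·x_2 + (a+2d)·x_3 with non-negative integers x_1, x_2, x_3 equals ⌊(a−2)/2⌋·a + (a−1)·d. -/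
/-- An integer is a non-negative combination of `a, a+d, a+2d` exactly when it has the form
`a * s + d * t` with `t ≤ 2 * s`. -/
theorem exists_combination_iff (a d n : ℕ) :
    (∃ x1 x2 x3 : ℕ, n = a * x1 + (a + d) * x2 + (a + 2 * d) * x3) ↔
      ∃ s t : ℕ, t ≤ 2 * s ∧ n = a * s + d * t := by
  constructor
  · rintro ⟨x1, x2, x3, rfl⟩
    exact ⟨x1 + x2 + x3, x2 + 2 * x3, by omega, by ring⟩
  · rintro ⟨s, t, hts, rfl⟩
    obtain ⟨x1, hx1⟩ : ∃ x1, s = x1 + t % 2 + t / 2 := ⟨s - t % 2 - t / 2, by omega⟩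
    refine ⟨x1, t % 2, t / 2, ?_⟩
    have ht : t = t % 2 + 2 * (t / 2) := by omega
    calc a * s + d * t
        = a * (x1 + t % 2 + t / 2) + d * (t % 2 + 2 * (t / 2)) := by rw [← hx1, ← ht]
      _ = _ := by ring

/-- (Roberts' formula.) For `gcd(a,d) = 1`, `d > 0` and `a ≥ 3`,
`g(a, a+d, a+2d) = ⌊(a-2)/2⌋*a + (a-1)*d`, i.e. this number is the greatest integer
not expressible as a non-negative integer combination of `a, a+d, a+2d`. -/
theorem stmt_16 (a d : ℕ) (ha : 3 ≤ a) (hd : 0 < d) (hcop : Nat.gcd a d = 1) :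
    IsGreatest {n : ℕ | ¬ ∃ x1 x2 x3 : ℕ, n = a * x1 + (a + d) * x2 + (a + 2 * d) * x3}
      ((a - 2) / 2 * a + (a - 1) * d) := by
  constructor
  · rw [Set.mem_ofPred_eq, exists_combination_iff]
    rintro ⟨s, t, hts, h⟩
    have hmod : d * t ≡ d * (a - 1) [MOD a] := by
      have h' := congrArg (· % a) h
      simpa [Nat.ModEq, Nat.add_mod, mul_comm] using h'.symm
    have hmod : t ≡ a - 1 [MOD a] := Nat.ModEq.cancel_left_of_coprime hcop hmod
    have ht : a - 1 ≤ t := by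
      have := Nat.mod_le t a
      rwa [hmod, Nat.mod_eq_of_lt (by omega)] at this
    have hs : (a - 2) / 2 < s := by omega
    have h1 : (a - 2) / 2 * a < a * s := by
      rw [mul_comm a]
      exact Nat.mul_lt_mul_of_pos_right hs (by omega)
    have h2 : (a - 1) * d ≤ d * t := by
      rw [mul_comm d]
      exact Nat.mul_le_mul_right d ht
    omega
  · intro n hn
    rw [Set.mem_ofPred_eq, exists_combination_iff] at hn
    by_contra! hlt
    obtain ⟨t, hta, ht⟩ :=
      Nat.exists_mul_mod_eq_of_coprime n (Nat.Coprime.symm hcop) (by omega : a ≠ 0)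
    have hdt : d * t ≤ (a - 1) * d := by
      rw [mul_comm d]
      exact Nat.mul_le_mul_right d (by omega)
    obtain ⟨s, hs⟩ := (Nat.modEq_iff_dvd' (by omega)).mp ht
    have hqs : (a - 2) / 2 < s := by
      refine Nat.lt_of_mul_lt_mul_left (a := a) ?_
      rw [← hs, mul_comm a]
      omega
    exact hn ⟨s, t, by omega, by omega⟩
end

section
/- Let 0 < a_1 < a_2 < a_3 be integers with a_2 ≡ 1 (mod a_1), and let j be the integer with 0 ≤ j < a_1 and a_3 ≡ j (mod a_1). If a_3 ≥ j·a_2, then G(a_1, a_2, a_3) = a_1·a_2 + a_3. -/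
/-- (Byrnes' formula, first case.) For `0 < a1 < a2 < a3` with
`a2 ≡ 1 (mod a1)`, `a3 ≡ j (mod a1)` with `0 ≤ j < a1`: if `a3 ≥ j*a2` then
`G(a1,a2,a3) = a1*a2 + a3`. -/
theorem stmt_17 (a1 a2 a3 j : ℕ) (h0 : 0 < a1) (h12 : a1 < a2) (h23 : a2 < a3)
    (hmod : a2 ≡ 1 [MOD a1]) (hj : j < a1) (hj3 : a3 ≡ j [MOD a1])
    (hge : j * a2 ≤ a3) :
    IsGreatest {N : ℕ | 0 < N ∧ ¬ ∃ x1 x2 x3 : ℕ, 0 < x1 ∧ 0 < x2 ∧ 0 < x3 ∧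
      N = a1 * x1 + a2 * x2 + a3 * x3} (a1 * a2 + a3) := by
  have ha2 : ∃ q, a2 = 1 + a1 * q := by
    obtain ⟨q, hq⟩ := (Nat.modEq_iff_dvd' (by omega)).mp hmod.symm
    exact ⟨q, by omega⟩
  have ha3 : ∃ k, a3 = j * a2 + a1 * k := by
    have h : j * a2 ≡ a3 [MOD a1] := by
      simpa using (hmod.mul_left j).trans (by simpa using hj3.symm)
    obtain ⟨k, hk⟩ := (Nat.modEq_iff_dvd' hge).mp h
    exact ⟨k, by omega⟩
  obtain ⟨q, hq⟩ := ha2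
  obtain ⟨k, hk⟩ := ha3
  have hcop : Nat.Coprime a1 a2 := by
    rw [hq]
    simp
  refine ⟨⟨by omega, ?_⟩, ?_⟩
  · rintro ⟨x1, x2, x3, hx1, hx2, hx3, h⟩
    obtain ⟨y, rfl⟩ : ∃ y, x3 = y + 1 := ⟨x3 - 1, by omega⟩
    have h' : a1 * a2 = a1 * (x1 + k * y) + a2 * (x2 + j * y) := by
      have h3 : a3 * y = (j * a2 + a1 * k) * y := by rw [← hk]
      linear_combination h + h3
    have hdvd : a1 ∣ a2 * (x2 + j * y) :=
      (Nat.dvd_add_right (Nat.dvd_mul_right a1 (x1 + k * y))).mp (h' ▸ Nat.dvd_mul_right a1 a2)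
    have hle : a1 ≤ x2 + j * y :=
      Nat.le_of_dvd (by omega) (hcop.dvd_of_dvd_mul_left hdvd)
    have hmul : a2 * a1 ≤ a2 * (x2 + j * y) := Nat.mul_le_mul_left a2 hle
    have hpos : 0 < a1 * (x1 + k * y) := Nat.mul_pos h0 (by omega)
    linarith [mul_comm a1 a2]
  · rintro N ⟨-, hN⟩
    by_contra! hlt
    obtain ⟨M, rfl⟩ : ∃ M, N = M + 1 + a3 := ⟨N - a3 - 1, by omega⟩
    have hr : M % a1 < a1 := Nat.mod_lt M h0
    have hM : a1 * (M / a1) + M % a1 = M := Nat.div_add_mod M a1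
    have hmul : a2 * (M % a1 + 1) ≤ a2 * a1 := Nat.mul_le_mul_left a2 hr
    have hsub : a2 * (M % a1 + 1) = M % a1 + 1 + a1 * (q * (M % a1 + 1)) := by
      nth_rewrite 1 [hq]
      ring
    have hlt' : a1 * (q * (M % a1 + 1)) < a1 * (M / a1) := by
      linarith [mul_comm a1 a2]
    obtain ⟨d, hd⟩ := Nat.exists_eq_add_of_lt (Nat.lt_of_mul_lt_mul_left hlt')
    refine hN ⟨d + 1, M % a1 + 1, 1, by omega, by omega, one_pos, ?_⟩
    rw [hd] at hM
    linarith
end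

section
/- Let 0 < a_1 < a_2 < a_3 be integers with a_2 ≡ 1 (mod a_1). Let j be the integer with 0 < j < a_1 and a_3 ≡ j (mod a_1), and let m be the unique integer with 1 ≤ m ≤ j and a_1 ≡ m (mod j) (so j divides a_1 − m). If (j − m)·a_2 < a_3 < j·a_2, then G(a_1, a_2, a_3) = ((a_1 − m)/j + 1)·a_3 + m·a_2. -/
/-- A combination `x * a2 + y * a3` with `x > 0` and `x + j * y` a positive multiple of
`q * j + m` is at least `q * a3 + m * a2`. -/
theorem le_of_add_mul_eq_mul {a2 a3 j m q x y k : ℤ} (ha2 : 0 < a2) (hj : 0 < j) (hq : 0 ≤ q)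
    (hm : 0 < m) (hmj : m ≤ j) (hlo : (j - m) * a2 < a3) (hhi : a3 < j * a2)
    (hx : 0 < x) (hk : 0 < k) (h : x + j * y = k * (q * j + m)) :
    q * a3 + m * a2 ≤ x * a2 + y * a3 := by
  rcases le_or_gt y q with hy | hy
  · have hx' : m + j * (q - y) ≤ x := by nlinarith [mul_nonneg hq hj.le]
    nlinarith [mul_le_mul_of_nonneg_right hx' ha2.le,
      mul_le_mul_of_nonneg_left hhi.le (sub_nonneg.2 hy)]
  · obtain ⟨p, hp⟩ : ∃ p, p = k * (q + 1) - y := ⟨_, rfl⟩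
    have hxp : x = p * j - k * (j - m) := by subst hp; linear_combination h
    have hp0 : 0 < p := by
      have h1 : 0 ≤ k * (j - m) := mul_nonneg hk.le (sub_nonneg.2 hmj)
      exact pos_of_mul_pos_left (by linarith : 0 < p * j) hj.le
    have hbound : m ≤ (j - m) * (y - q) + x := by
      have h1 : (j - m) * (y - q) + x = (j - m) * ((k - 1) * q) + p * m := by
        rw [hxp, show y = k * (q + 1) - p by linarith]; ring
      have h2 : 0 ≤ (j - m) * ((k - 1) * q) :=
        mul_nonneg (sub_nonneg.2 hmj) (mul_nonneg (by omega) hq)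
      nlinarith
    nlinarith [mul_le_mul_of_nonneg_right hbound ha2.le,
      mul_le_mul_of_nonneg_right hlo.le (sub_nonneg.2 hy.le)]

/-- (Byrnes' formula, second case.) For `0 < a1 < a2 < a3` with
`a2 ≡ 1 (mod a1)`, `a3 ≡ j (mod a1)` with `0 < j < a1`, and `a1 ≡ m (mod j)` with
`1 ≤ m ≤ j`: if `(j-m)*a2 < a3 < j*a2` then
`G(a1,a2,a3) = ((a1-m)/j + 1)*a3 + m*a2`. -/
theorem stmt_18 (a1 a2 a3 j m : ℕ) (h0 : 0 < a1) (h12 : a1 < a2) (h23 : a2 < a3)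
    (hmod : a2 ≡ 1 [MOD a1]) (hj0 : 0 < j) (hj : j < a1) (hj3 : a3 ≡ j [MOD a1])
    (hm1 : 1 ≤ m) (hmj : m ≤ j) (hm : a1 ≡ m [MOD j])
    (hlo : (j - m) * a2 < a3) (hhi : a3 < j * a2) :
    IsGreatest {N : ℕ | 0 < N ∧ ¬ ∃ x1 x2 x3 : ℕ, 0 < x1 ∧ 0 < x2 ∧ 0 < x3 ∧
        N = a1 * x1 + a2 * x2 + a3 * x3}
      (((a1 - m) / j + 1) * a3 + m * a2) := by
  have hma : m ≤ a1 := by omega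
  obtain ⟨q, hq⟩ : j ∣ a1 - m := (Nat.modEq_iff_dvd' hma).1 hm.symm
  have ha1 : a1 = q * j + m := by rw [mul_comm] at hq; omega
  rw [hq, Nat.mul_div_cancel_left q hj0]
  have hq1 : 1 ≤ q := by
    rcases Nat.eq_zero_or_pos q with h | h
    · subst h; omega
    · exact h
  have ha2 : 0 < a2 := by omega
  have hloZ : ((j : ℤ) - m) * a2 < a3 := by
    rw [← Nat.cast_sub hmj]; exact_mod_cast hlo
  have ha1Z : (a1 : ℤ) = q * j + m := by exact_mod_cast ha1
  obtain ⟨u, hu⟩ := hmod.dvd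
  obtain ⟨v, hv⟩ := hj3.dvd
  push_cast at hu
  refine ⟨⟨by positivity, ?_⟩, ?_⟩
  · rintro ⟨x1, x2, x3, h1, h2, h3, h⟩
    have hZ : ((q : ℤ) + 1) * a3 + m * a2 = a1 * x1 + a2 * x2 + a3 * x3 := by exact_mod_cast h
    obtain ⟨k, hk⟩ : ∃ k : ℤ, (x2 : ℤ) + j * (x3 - 1) = k * (q * j + m) := by
      refine ⟨1 - x1 + u * (x2 - m) + v * (x3 - q - 1), ?_⟩
      rw [← ha1Z]
      linear_combination -hZ + (x2 - m) * hu + (x3 - q - 1) * hv - ha1Z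
    have hk0 : 0 < k := by
      have hx3 : (0 : ℤ) ≤ j * (x3 - 1) := mul_nonneg (by omega) (by omega)
      rw [← ha1Z] at hk
      exact pos_of_mul_pos_left (by omega : 0 < k * (a1 : ℤ)) (by omega)
    have hle := le_of_add_mul_eq_mul (a2 := a2) (a3 := a3) (by omega) (by omega) (by omega)
      (by omega) (by omega) hloZ (by exact_mod_cast hhi) (by omega) hk0 hk
    have hpos : (0 : ℤ) < a1 * x1 := by exact_mod_cast Nat.mul_pos h0 h1
    linarith
  · rintro N ⟨-, hN⟩
    by_contra! hlt
    obtain ⟨r, hr0, hr, w, hw⟩ : ∃ r : ℤ, 0 ≤ r ∧ r < a1 ∧ ∃ w : ℤ, (N : ℤ) - 1 - j = a1 * w + r :=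
      ⟨_, Int.emod_nonneg _ (by omega), Int.emod_lt_of_pos _ (by omega), _,
        (Int.mul_ediv_add_emod ((N : ℤ) - 1 - j) a1).symm⟩
    lift r to ℕ using hr0
    obtain ⟨s, t, htj, hst⟩ : ∃ s t : ℕ, t < j ∧ r = j * s + t :=
      ⟨r / j, r % j, Nat.mod_lt _ hj0, (Nat.div_add_mod r j).symm⟩
    have hW : (s + 1) * a3 + (t + 1) * a2 ≤ (q + 1) * a3 + m * a2 := by
      rcases lt_or_ge s q with hs | hs
      · have hs' : (s + 1) * a3 ≤ q * a3 := Nat.mul_le_mul_right _ hs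
        have ht' : (t + 1) * a2 ≤ j * a2 := Nat.mul_le_mul_right _ htj
        zify at hs' ht' ⊢
        linarith
      · have hjs : j * q + j * (s - q) = j * s := by rw [← mul_add]; congr 1; omega
        have hqj := mul_comm q j
        have hsq : s = q := by
          by_contra hne
          have : j * 1 ≤ j * (s - q) := Nat.mul_le_mul_left _ (by omega)
          omega
        subst hsq
        have : t + 1 ≤ m := by omega
        gcongr
    have hx : (N : ℤ) - ((s + 1) * a3 + (t + 1) * a2) = a1 * (w + u * (t + 1) + v * (s + 1)) := by
      have hstZ : (r : ℤ) = j * s + t := by exact_mod_cast hst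
      linear_combination hw + hstZ + (t + 1) * hu + (s + 1) * hv
    have hpos : 0 < w + u * (t + 1) + v * (s + 1) := by
      have : (0 : ℤ) < N - ((s + 1) * a3 + (t + 1) * a2) := by
        have := hW.trans_lt hlt
        zify at this
        linarith
      rw [hx] at this
      exact pos_of_mul_pos_right this (by omega)
    obtain ⟨x1, hx1⟩ := Int.eq_ofNat_of_zero_le hpos.le
    refine hN ⟨x1, t + 1, s + 1, by omega, by omega, by omega, ?_⟩
    rw [hx1] at hx
    zify
    linear_combination hx
end

section
/- Let 0 < a_1 < a_2 < a_3 be integers with a_2 ≡ 1 (mod a_1). Let j be the integer with 0 < j < a_1 and a_3 ≡ j (mod a_1), and let m be the unique integer with 1 ≤ m ≤ j and a_1 ≡ m (mod j) (so j divides a_1 − m). If j·(j − m)·a_2 ≤ (a_1 − m + j)·a_3 and a_3 < (j − m)·a_2, then G(a_1, a_2, a_3) = ((a_1 − m)/j)·a_3 + j·a_2. -/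
/-- The corner of the fundamental L-shaped region: no pair of positive integers in the class of
`(j, q)` modulo the lattice `x + j * y ≡ 0 (mod q * j + m)` has smaller weight. -/
lemma corner_weight_le {q j m b c x y k : ℤ} (hq : 1 ≤ q) (hm : 1 ≤ m) (hmj : m < j)
    (hx : 1 ≤ x) (hy : 1 ≤ y) (hbc : c ≤ j * b) (hlo : (j - m) * b ≤ (q + 1) * c)
    (hk : x + j * y - (j + j * q) = (q * j + m) * k) :
    j * b + q * c ≤ b * x + c * y := by
  obtain ⟨u, hu⟩ : ∃ u, u = q + k * (q + 1) - y := ⟨_, rfl⟩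
  have hy' : y = q + k * (q + 1) - u := by linarith
  have hx' : x = j + u * j - k * (j - m) := by
    subst hy'
    linear_combination hk
  have hk0 : 0 ≤ k := by
    by_contra! hk0
    have hu0 : u < 0 := by nlinarith
    have huk : k ≤ u := by
      by_contra! h
      nlinarith [mul_nonneg (by linarith : (0 : ℤ) ≤ k - u - 1) (by linarith : (0 : ℤ) ≤ j),
        mul_nonneg (by linarith : (0 : ℤ) ≤ -k - 1) (by linarith : (0 : ℤ) ≤ m - 1)]
    nlinarith
  have hu0 : 0 ≤ u := by
    by_contra! hu0
    nlinarith [mul_nonneg hk0 (by linarith : (0 : ℤ) ≤ j - m)]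
  have h1 := mul_nonneg hu0 (sub_nonneg.2 hbc)
  have h2 := mul_nonneg hk0 (sub_nonneg.2 hlo)
  have h3 : b * x + c * y
      = j * b + q * c + (u * (j * b - c) + k * ((q + 1) * c - (j - m) * b)) := by
    rw [hx', hy']
    ring
  linarith

/-- The L-shaped region meets every residue class, and its points have weight at most that of
the corner `(j, q)`. -/
lemma exists_pair_weight_le {q j m b c : ℤ} (hq : 1 ≤ q) (hm : 1 ≤ m) (hmj : m < j)
    (hb : 0 ≤ b) (hc : 0 ≤ c) (hhi : c ≤ (j - m) * b) (N : ℤ) :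
    ∃ x y : ℤ, 1 ≤ x ∧ 1 ≤ y ∧ q * j + m ∣ N - (x + j * y) ∧
      b * x + c * y ≤ j * b + q * c := by
  have hj : 0 < j := by linarith
  have ha : 0 < q * j + m := by positivity
  set r := (N - 1 - j) % (q * j + m) with hr
  have hr0 : 0 ≤ r := Int.emod_nonneg _ ha.ne'
  have hra : r < q * j + m := Int.emod_lt_of_pos _ ha
  have hs0 : 0 ≤ r % j := Int.emod_nonneg _ hj.ne'
  have hsj : r % j < j := Int.emod_lt_of_pos _ hj
  have ht0 : 0 ≤ r / j := Int.ediv_nonneg hr0 hj.le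
  have hst : r % j + j * (r / j) = r := Int.emod_add_mul_ediv r j
  refine ⟨r % j + 1, r / j + 1, by linarith, by linarith, ?_, ?_⟩
  · have h : N - (r % j + 1 + j * (r / j + 1)) = N - 1 - j - r := by linear_combination -hst
    rw [h, hr]
    exact Int.dvd_self_sub_emod
  · generalize r % j = s at *
    generalize r / j = t at *
    rcases lt_or_ge t q with h | h
    · nlinarith [mul_nonneg hb (by linarith : (0 : ℤ) ≤ j - (s + 1)),
        mul_nonneg hc (by linarith : (0 : ℤ) ≤ q - (t + 1))]
    · have htq : t = q := by
        by_contra hne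
        have : q + 1 ≤ t := by omega
        nlinarith
      subst htq
      have hsm : s + 1 ≤ m := by linarith
      nlinarith [mul_nonneg hb (sub_nonneg.2 hsm)]


/-- (Byrnes' formula, third case.) For `0 < a1 < a2 < a3` with
`a2 ≡ 1 (mod a1)`, `a3 ≡ j (mod a1)` with `0 < j < a1`, and `a1 ≡ m (mod j)` with
`1 ≤ m ≤ j`: if `j*(j-m)*a2 ≤ (a1-m+j)*a3` and `a3 < (j-m)*a2` then
`G(a1,a2,a3) = ((a1-m)/j)*a3 + j*a2`. -/
theorem stmt_19 (a1 a2 a3 j m : ℕ) (h0 : 0 < a1) (h12 : a1 < a2) (h23 : a2 < a3)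
    (hmod : a2 ≡ 1 [MOD a1]) (hj0 : 0 < j) (hj : j < a1) (hj3 : a3 ≡ j [MOD a1])
    (hm1 : 1 ≤ m) (hmj : m ≤ j) (hm : a1 ≡ m [MOD j])
    (hlo : j * (j - m) * a2 ≤ (a1 - m + j) * a3) (hhi : a3 < (j - m) * a2) :
    IsGreatest {N : ℕ | 0 < N ∧ ¬ ∃ x1 x2 x3 : ℕ, 0 < x1 ∧ 0 < x2 ∧ 0 < x3 ∧
        N = a1 * x1 + a2 * x2 + a3 * x3}
      ((a1 - m) / j * a3 + j * a2) := by
  have hjm : m < j := by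
    by_contra! h
    simp [Nat.sub_eq_zero_of_le h] at hhi
  obtain ⟨q, hq⟩ := (Nat.modEq_iff_dvd' (by omega : m ≤ a1)).1 hm.symm
  have hdiv : (a1 - m) / j = q := by rw [hq, Nat.mul_div_cancel_left _ hj0]
  rw [hdiv]
  have hq1 : 1 ≤ q := by
    rcases Nat.eq_zero_or_pos q with rfl | h
    · omega
    · exact h
  have hlo' : (j - m) * a2 ≤ (q + 1) * a3 := by
    refine Nat.le_of_mul_le_mul_left ?_ hj0
    rw [hq] at hlo
    linarith
  have ha1 : (a1 : ℤ) = q * j + m := by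
    have : a1 = j * q + m := by omega
    rw [this]
    push_cast
    ring
  zify [hjm.le] at hlo' hhi
  obtain ⟨c, hc⟩ := hmod.symm.dvd
  obtain ⟨d, hd⟩ := hj3.symm.dvd
  push_cast at hc hd
  have hq1' : (1 : ℤ) ≤ q := by exact_mod_cast hq1
  have hm1' : (1 : ℤ) ≤ m := by exact_mod_cast hm1
  have hjm' : (m : ℤ) < j := by exact_mod_cast hjm
  have ha1' : (0 : ℤ) < a1 := by exact_mod_cast h0
  constructor
  · refine ⟨Nat.add_pos_right _ (Nat.mul_pos hj0 (by omega)), ?_⟩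
    rintro ⟨x1, x2, x3, hx1, hx2, hx3, h⟩
    zify at h hx1 hx2 hx3
    have hmin := corner_weight_le (b := (a2 : ℤ)) (c := (a3 : ℤ)) (x := x2) (y := x3)
      (k := c * (j - x2) + d * (q - x3) - x1)
      hq1' hm1' hjm' hx2 hx3 (by nlinarith) hlo' (by
        rw [← ha1]
        linear_combination ((j : ℤ) - x2) * hc + ((q : ℤ) - x3) * hd - h)
    nlinarith [mul_pos ha1' hx1]
  · rintro N ⟨-, hN⟩
    by_contra! hlt
    refine hN ?_
    obtain ⟨x, y, hx, hy, ⟨k, hk⟩, hle⟩ := exists_pair_weight_le (b := (a2 : ℤ)) (c := (a3 : ℤ))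
      hq1' hm1' hjm' (by positivity) (by positivity) hhi.le N
    rw [← ha1] at hk
    zify at hlt
    have hN' : (N : ℤ) = a1 * (k - c * x - d * y) + a2 * x + a3 * y := by
      linear_combination hk - x * hc - y * hd
    have hz : 0 < k - c * x - d * y := by
      refine pos_of_mul_pos_right ?_ ha1'.le
      linarith
    generalize k - c * x - d * y = z at hN' hz
    lift x to ℕ using by linarith
    lift y to ℕ using by linarith
    lift z to ℕ using hz.le
    exact ⟨z, x, y, by exact_mod_cast hz, by exact_mod_cast hx, by exact_mod_cast hy,
      by exact_mod_cast hN'⟩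
end
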